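/- arXiv:1609.06025 — 2 statements merged into one kernel-verified Lean document; each statement's English description precedes it below -/
import Mathlib

section
/- Let P ∈ 𝕂[X₁,…,Xₙ,U₁,…,Uₙ] be such that Z(P) ⊆ ℝ^{2n} is an irreducible real algebraic set over 𝕂, let f = E(P) and V = Z(f) with dim V = n−1. Let T be an irreducible component of V (as an exponential set over 𝕂) with dim T = n−1, such that T = Z(E(S)) for some S ∈ 𝕂[X₁,…,Xₙ,U₁,…,Uₙ] with Z(S) ⊆ ℝ^{2n} irreducible over 𝕂, and suppose there exists a real algebraic set B over 𝕂 with dim B = n−1 and T_{n−1} ⊆ B. Then either V = T or T_{n−1} ⊆ W_P. -/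
open MeasureTheory Set
open scoped ENNReal

noncomputable section

/-- `K` is a real algebraic extension of `ℚ`: every element of `K` is algebraic over `ℚ`. -/
def RealAlgExt (K : Subfield ℝ) : Prop := ∀ a : K, IsAlgebraic ℚ (a : ℝ)

/-- A real polynomial has all its coefficients in the subfield `K` of `ℝ`. -/
def CoeffsIn {σ : Type*} (K : Subfield ℝ) (P : MvPolynomial σ ℝ) : Prop :=
  ∀ m, P.coeff m ∈ K

/-- Evaluation of a polynomial in `X₁,…,Xₙ,U₁,…,Uₙ` at `(x, e^x)`:
the E-polynomial associated to `P`. -/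
def expEval {n : ℕ} (P : MvPolynomial (Fin n ⊕ Fin n) ℝ) (x : Fin n → ℝ) : ℝ :=
  MvPolynomial.eval (Sum.elim x fun i => Real.exp (x i)) P

/-- Exponential sets over `K` in `ℝⁿ`: zero sets of E-polynomials over `K`. -/
def IsExpSet {n : ℕ} (K : Subfield ℝ) (V : Set (Fin n → ℝ)) : Prop :=
  ∃ P : MvPolynomial (Fin n ⊕ Fin n) ℝ, CoeffsIn K P ∧ V = {x | expEval P x = 0}

/-- Real algebraic sets over `K` (in coordinates indexed by `σ`). -/
def IsAlgSet {σ : Type*} (K : Subfield ℝ) (S : Set (σ → ℝ)) : Prop :=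
  ∃ P : MvPolynomial σ ℝ, CoeffsIn K P ∧ S = {x | MvPolynomial.eval x P = 0}

/-- An exponential set is irreducible if it is nonempty and is not the union of
two proper exponential subsets. -/
def IsIrredExpSet {n : ℕ} (K : Subfield ℝ) (V : Set (Fin n → ℝ)) : Prop :=
  IsExpSet K V ∧ V.Nonempty ∧
    ¬ ∃ V₁ V₂ : Set (Fin n → ℝ),
      IsExpSet K V₁ ∧ IsExpSet K V₂ ∧ V = V₁ ∪ V₂ ∧ V₁ ⊂ V ∧ V₂ ⊂ V

/-- `T` is an irreducible component of `V`: a maximal irreducible exponential subset of `V`. -/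
def IsExpComponent {n : ℕ} (K : Subfield ℝ) (T V : Set (Fin n → ℝ)) : Prop :=
  IsIrredExpSet K T ∧ T ⊆ V ∧
    ∀ T', IsIrredExpSet K T' → T ⊆ T' → T' ⊆ V → T' = T

/-- A real algebraic set is irreducible over `K` if it is nonempty and is not the union of
two proper algebraic subsets over `K`. -/
def IsIrredAlgSet {σ : Type*} (K : Subfield ℝ) (V : Set (σ → ℝ)) : Prop :=
  IsAlgSet K V ∧ V.Nonempty ∧
    ¬ ∃ V₁ V₂ : Set (σ → ℝ),
      IsAlgSet K V₁ ∧ IsAlgSet K V₂ ∧ V = V₁ ∪ V₂ ∧ V₁ ⊂ V ∧ V₂ ⊂ V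

/-- `T` is an irreducible component over `K` of the real algebraic set `V`. -/
def IsAlgComponent {σ : Type*} (K : Subfield ℝ) (T V : Set (σ → ℝ)) : Prop :=
  IsIrredAlgSet K T ∧ T ⊆ V ∧
    ∀ T', IsIrredAlgSet K T' → T ⊆ T' → T' ⊆ V → T' = T

/-- Local (Hausdorff) dimension of `A` at `x`. -/
def locDim {n : ℕ} (A : Set (Fin n → ℝ)) (x : Fin n → ℝ) : ℝ≥0∞ :=
  ⨅ (ε : ℝ) (_ : 0 < ε), dimH (A ∩ Metric.ball x ε)

/-- `A_p`: the set of points of `A` at which `A` has local dimension `p`. -/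
def localSet {n : ℕ} (A : Set (Fin n → ℝ)) (p : ℕ) : Set (Fin n → ℝ) :=
  {x | x ∈ A ∧ locDim A x = (p : ℝ≥0∞)}

/-- The exponent vectors of the `U`-monomials of `P` (with nonzero coefficient in `𝕂[X]`). -/
def Uexps {n : ℕ} (P : MvPolynomial (Fin n ⊕ Fin n) ℝ) : Set (Fin n → ℕ) :=
  (fun (m : (Fin n ⊕ Fin n) →₀ ℕ) (i : Fin n) => m (Sum.inr i)) '' (P.support : Set _)

/-- The union `W_P` of the linear hyperplane sets associated to pairs of distinct
`U`-monomials of `P`. -/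
def WP {n : ℕ} (P : MvPolynomial (Fin n ⊕ Fin n) ℝ) : Set (Fin n → ℝ) :=
  {x | ∃ d e : Fin n → ℕ, d ∈ Uexps P ∧ e ∈ Uexps P ∧ d ≠ e ∧
    ∑ i, (d i : ℝ) * x i = ∑ i, (e i : ℝ) * x i}

/-- Schanuel's conjecture over the reals, with "the transcendence degree of
`ℚ(x₁,…,xₙ,e^{x₁},…,e^{xₙ})` over `ℚ` is less than `n`" expressed as: no `n`-tuple of
elements of `{x₁,…,xₙ,e^{x₁},…,e^{xₙ}}` is algebraically independent over `ℚ`. -/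
def SchanuelConjecture : Prop :=
  ∀ (n : ℕ) (x : Fin n → ℝ),
    (¬ ∃ v : Fin n → ℝ,
        (∀ i, v i ∈ Set.range x ∪ Set.range fun j => Real.exp (x j)) ∧
        AlgebraicIndependent ℚ v) →
    ∃ m : Fin n → ℤ, (∃ i, m i ≠ 0) ∧ ∑ i, (m i : ℝ) * x i = 0

lemma isIntegral_pow_mul_aeval {R L : Type*} [CommRing R] [Field L] [Algebra R L] {a : R}
    {x : L} (h : IsIntegral R (a • x)) (g : Polynomial R) {m : ℕ} (hm : g.natDegree ≤ m) :
    IsIntegral R (a ^ m • Polynomial.aeval x g) := by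
  rw [Polynomial.aeval_eq_sum_range' (Nat.lt_succ_of_le hm), Finset.smul_sum]
  refine IsIntegral.sum _ fun i hi => ?_
  have hi' : i ≤ m := Nat.lt_succ_iff.1 (Finset.mem_range.1 hi)
  have : a ^ m • g.coeff i • x ^ i = (g.coeff i * a ^ (m - i)) • (a • x) ^ i := by
    rw [smul_pow, smul_smul, smul_smul, mul_assoc, ← pow_add, Nat.sub_add_cancel hi', mul_comm]
  rw [this]
  exact (h.pow i).smul _

lemma exists_int_polynomial_vanishing {L : Type*} [Field L] [CharZero L] [Algebra.IsAlgebraic ℚ L]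
    (S : Finset L) (hS : (0 : L) ∉ S) :
    ∃ f : Polynomial ℤ, f.eval 0 ≠ 0 ∧ ∀ x ∈ S, Polynomial.aeval x f = 0 := by
  have key : ∀ x : L, x ≠ 0 → ∃ q : Polynomial ℤ, q.coeff 0 ≠ 0 ∧ Polynomial.aeval x q = 0 := by
    intro x hx
    have h : IsAlgebraic ℤ x :=
      (IsFractionRing.isAlgebraic_iff ℤ ℚ L).2 (Algebra.IsAlgebraic.isAlgebraic x)
    exact h.exists_nonzero_coeff_and_aeval_eq_zero (mem_nonZeroDivisors_of_ne_zero hx)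
  choose! q hq0 hq using key
  refine ⟨∏ x ∈ S, q x, ?_, fun x hx => ?_⟩
  · rw [Polynomial.eval_prod, Finset.prod_ne_zero_iff]
    intro x hx
    rw [← Polynomial.coeff_zero_eq_eval_zero]
    exact hq0 x (fun h => hS (h ▸ hx))
  · rw [map_prod]
    exact Finset.prod_eq_zero hx (hq x (fun h => hS (h ▸ hx)))

open Nat Filter Topology in
lemma eventually_pow_div_factorial_pred_lt_one (A c C : ℝ) (d : ℕ) :
    ∀ᶠ p : ℕ in atTop, A ^ (p * d) * (C * (c ^ p / (p - 1)!)) < 1 := by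
  have h := (FloorSemiring.tendsto_pow_div_factorial_atTop (A ^ d * c)).const_mul (A ^ d * C * c)
  rw [mul_zero] at h
  have h1 : ∀ᶠ p : ℕ in atTop, A ^ d * C * c * ((A ^ d * c) ^ p / (p ! : ℝ)) < 1 :=
    h.eventually_lt_const one_pos
  have h2 := (tendsto_sub_atTop_nat 1).eventually h1
  filter_upwards [h2, eventually_ge_atTop 1] with p hp hp1
  obtain ⟨k, rfl⟩ := Nat.exists_eq_add_of_le' hp1
  simp only [Nat.add_sub_cancel] at hp ⊢
  refine lt_of_eq_of_lt ?_ hp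
  ring

/-- The analytic part of the Lindemann–Weierstrass theorem combined with a size estimate: a
Galois invariant integral relation between exponentials has no constant term. -/
lemma not_galois_invariant_exp_relation {L : Type*} [Field L] [CharZero L] [Algebra L ℂ]
    [FiniteDimensional ℚ L] [IsGalois ℚ L] (S : Finset L) (z : L → ℤ)
    (hS0 : (0 : L) ∉ S) (hSinv : ∀ (τ : L ≃ₐ[ℚ] L), ∀ x ∈ S, τ x ∈ S)
    (hz : ∀ (τ : L ≃ₐ[ℚ] L) x, z (τ x) = z x) (hz0 : z 0 ≠ 0) :
    (z 0 : ℂ) + ∑ x ∈ S, (z x : ℂ) * Complex.exp (algebraMap L ℂ x) ≠ 0 := by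
  intro hrel
  obtain ⟨f, hf0, hf⟩ := exists_int_polynomial_vanishing S hS0
  obtain ⟨a, ha0, ha⟩ := exists_integral_multiples ℤ ℚ S
  obtain ⟨c, hc⟩ := LindemannWeierstrass.exp_polynomial_approx f hf0
  set C : ℝ := ∑ x ∈ S, |(z x : ℝ)| with hC
  have hev := (eventually_pow_div_factorial_pred_lt_one |(a : ℝ)| c C f.natDegree).and
    (Filter.eventually_ge_atTop ((f.eval 0).natAbs + a.natAbs + (z 0).natAbs + 1))
  obtain ⟨p, hpp, hplt, hpge⟩ := ((Nat.frequently_atTop_iff_infinite.2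
    Nat.infinite_setOfPred_prime).and_eventually hev).exists
  replace hpp : p.Prime := hpp
  obtain ⟨n, hpn, gp, hgp, happ⟩ := hc p (by omega) hpp
  set m := p * f.natDegree with hm
  have hgp' : gp.natDegree ≤ m := hgp.trans (Nat.sub_le _ _)
  set Y : L := ∑ x ∈ S, (z x : L) * Polynomial.aeval x gp with hY
  have hYfix : ∀ τ : L ≃ₐ[ℚ] L, τ Y = Y := by
    intro τ
    rw [hY, map_sum]
    have : ∀ x ∈ S, τ ((z x : L) * Polynomial.aeval x gp)
        = (z (τ x) : L) * Polynomial.aeval (τ x) gp := by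
      intro x _
      rw [map_mul, hz, map_intCast]
      congr 1
      exact (Polynomial.aeval_algHom_apply ((τ : L →ₐ[ℚ] L).restrictScalars ℤ) x gp).symm
    rw [Finset.sum_congr rfl this]
    refine Finset.sum_nbij (fun x => τ x) (fun x hx => hSinv τ x hx) (τ.injective.injOn) ?_
      (fun _ _ => rfl)
    intro x hx
    exact ⟨τ.symm x, hSinv τ.symm x hx, by simp⟩
  obtain ⟨r, hr⟩ := (IsGalois.mem_range_algebraMap_iff_fixed (F := ℚ) Y).2 hYfix
  have h_int : IsIntegral ℤ (a ^ m • Y) := by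
    rw [hY, Finset.smul_sum]
    refine IsIntegral.sum _ fun x hx => ?_
    have : a ^ m • ((z x : L) * Polynomial.aeval x gp) = z x • (a ^ m • Polynomial.aeval x gp) := by
      simp only [zsmul_eq_mul]; ring
    rw [this]
    exact (isIntegral_pow_mul_aeval (ha x hx) gp hgp').smul _
  have h_int2 : IsIntegral ℤ (a ^ m • r) := by
    have : a ^ m • Y = algebraMap ℚ L (a ^ m • r) := by rw [← hr, map_zsmul]
    rw [this] at h_int
    exact (isIntegral_algebraMap_iff (algebraMap ℚ L).injective).1 h_int
  obtain ⟨k, hk⟩ := IsIntegrallyClosed.isIntegral_iff.1 h_int2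
  have hkY : (k : ℂ) = (a : ℂ) ^ m * algebraMap L ℂ Y := by
    have h1 : (k : L) = a ^ m • Y := by
      rw [← hr, ← map_zsmul, ← hk]; simp
    have := congrArg (algebraMap L ℂ) h1
    simpa [zsmul_eq_mul] using this
  have hYC : algebraMap L ℂ Y = ∑ x ∈ S, (z x : ℂ) * Polynomial.aeval (algebraMap L ℂ x) gp := by
    rw [hY, map_sum]
    refine Finset.sum_congr rfl fun x _ => ?_
    rw [map_mul, map_intCast, Polynomial.aeval_algebraMap_apply]
  have hbound : ‖(n : ℂ) * z 0 + p * algebraMap L ℂ Y‖ ≤ C * (c ^ p / (p - 1).factorial) := by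
    have h1 : (n : ℂ) * z 0 + p * algebraMap L ℂ Y
        = - ∑ x ∈ S, (z x : ℂ) * (n • Complex.exp (algebraMap L ℂ x)
            - p • Polynomial.aeval (algebraMap L ℂ x) gp) := by
      have h2 : (z 0 : ℂ) = - ∑ x ∈ S, (z x : ℂ) * Complex.exp (algebraMap L ℂ x) :=
        eq_neg_of_add_eq_zero_left hrel
      rw [h2, hYC, mul_neg, Finset.mul_sum, Finset.mul_sum, ← Finset.sum_neg_distrib,
        ← Finset.sum_neg_distrib, ← Finset.sum_add_distrib]
      refine Finset.sum_congr rfl fun x _ => ?_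
      simp only [zsmul_eq_mul, nsmul_eq_mul]; ring
    rw [h1, norm_neg, hC, Finset.sum_mul]
    refine norm_sum_le_of_le _ fun x hx => ?_
    rw [norm_mul]
    have : ‖(z x : ℂ)‖ = |(z x : ℝ)| := by simp
    rw [this]
    gcongr
    refine happ ?_
    rw [Polynomial.mem_aroots]
    refine ⟨fun h => hf0 (by simp [h]), ?_⟩
    rw [Polynomial.aeval_algebraMap_apply, hf x hx, map_zero]
  have hN : ‖((a ^ m * n * z 0 + p * k : ℤ) : ℂ)‖ < 1 := by
    have : ((a ^ m * n * z 0 + p * k : ℤ) : ℂ)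
        = (a : ℂ) ^ m * ((n : ℂ) * z 0 + p * algebraMap L ℂ Y) := by
      push_cast; rw [hkY]; ring
    rw [this, norm_mul, norm_pow]
    have h2 : ‖(a : ℂ)‖ = |(a : ℝ)| := by simp
    rw [h2]
    exact lt_of_le_of_lt (by gcongr) hplt
  have hN0 : a ^ m * n * z 0 + p * k = 0 := by
    rw [Complex.norm_intCast] at hN
    exact Int.abs_lt_one_iff.1 (by exact_mod_cast hN)
  have hpZ : Prime (p : ℤ) := Nat.prime_iff_prime_int.1 hpp
  have hdvd : (p : ℤ) ∣ a ^ m * n * z 0 := ⟨-k, by linarith⟩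
  rcases hpZ.dvd_or_dvd hdvd with h | h
  · rcases hpZ.dvd_or_dvd h with h | h
    · have := Int.le_of_dvd (by positivity) ((dvd_abs _ _).2 (hpZ.dvd_of_dvd_pow h))
      rw [Int.abs_eq_natAbs] at this
      omega
    · exact hpn h
  · have := Int.le_of_dvd (by positivity) ((dvd_abs _ _).2 h)
    rw [Int.abs_eq_natAbs] at this
    omega

/-- The evaluation `∑ c_x [x] ↦ ∑ c_x e^x` on the group algebra. -/
def expGroupAlgebraEval (L : Type*) [Field L] [Algebra L ℂ] : AddMonoidAlgebra L L →ₐ[L] ℂ :=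
  AddMonoidAlgebra.lift L ℂ L
    { toFun := fun x => Complex.exp (algebraMap L ℂ x.toAdd)
      map_one' := by simp
      map_mul' := fun x y => by simp [Complex.exp_add] }

lemma expGroupAlgebraEval_apply {L : Type*} [Field L] [Algebra L ℂ] (u : AddMonoidAlgebra L L) :
    expGroupAlgebraEval L u
      = ∑ x ∈ u.coeff.support, algebraMap L ℂ (u.coeff x) * Complex.exp (algebraMap L ℂ x) := by
  simp only [expGroupAlgebraEval, AddMonoidAlgebra.lift_apply, Finsupp.sum, Algebra.smul_def]
  rfl

section
variable {L : Type*} [Field L] [CharZero L]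

/-- The action of a field automorphism on the exponents of the group algebra. -/
abbrev expAct (τ : L ≃ₐ[ℚ] L) : AddMonoidAlgebra L L →+* AddMonoidAlgebra L L :=
  AddMonoidAlgebra.mapDomainRingHom L (τ : L →+ L)

/-- The action of a field automorphism on the coefficients of the group algebra. -/
abbrev coeffAct (σ : L ≃ₐ[ℚ] L) : AddMonoidAlgebra L L →+* AddMonoidAlgebra L L :=
  AddMonoidAlgebra.mapRingHom L (σ : L →+* L)

lemma coeff_expAct (τ : L ≃ₐ[ℚ] L) (u : AddMonoidAlgebra L L) (x : L) :
    (expAct τ u).coeff (τ x) = u.coeff x := by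
  change (Finsupp.mapDomain τ u.coeff) (τ x) = _
  exact Finsupp.mapDomain_apply τ.injective _ _

lemma coeff_coeffAct (σ : L ≃ₐ[ℚ] L) (u : AddMonoidAlgebra L L) (x : L) :
    (coeffAct σ u).coeff x = σ (u.coeff x) := rfl

lemma expAct_mul (τ τ' : L ≃ₐ[ℚ] L) (u : AddMonoidAlgebra L L) :
    expAct (τ * τ') u = expAct τ (expAct τ' u) := by
  ext x
  obtain ⟨y, rfl⟩ := (τ * τ').surjective x
  rw [coeff_expAct, AlgEquiv.mul_apply, coeff_expAct, coeff_expAct]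

lemma coeffAct_mul (τ τ' : L ≃ₐ[ℚ] L) (u : AddMonoidAlgebra L L) :
    coeffAct (τ * τ') u = coeffAct τ (coeffAct τ' u) := by
  ext x
  simp only [coeff_coeffAct, AlgEquiv.mul_apply]

lemma coeffAct_expAct (σ τ : L ≃ₐ[ℚ] L) (u : AddMonoidAlgebra L L) :
    coeffAct σ (expAct τ u) = expAct τ (coeffAct σ u) := by
  ext x
  obtain ⟨y, rfl⟩ := τ.surjective x
  simp only [coeff_coeffAct, coeff_expAct]

lemma expAct_ne_zero (τ : L ≃ₐ[ℚ] L) {u : AddMonoidAlgebra L L} (hu : u ≠ 0) :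
    expAct τ u ≠ 0 := by
  contrapose! hu
  ext x
  rw [← coeff_expAct τ, hu]; rfl

lemma coeffAct_ne_zero (τ : L ≃ₐ[ℚ] L) {u : AddMonoidAlgebra L L} (hu : u ≠ 0) :
    coeffAct τ u ≠ 0 := by
  contrapose! hu
  ext x
  have h := coeff_coeffAct τ u x
  rw [hu] at h
  exact (map_eq_zero τ).1 h.symm

variable [Algebra L ℂ] [FiniteDimensional ℚ L]

lemma exists_galois_invariant_of_expGroupAlgebraEval_eq_zero
    {u : AddMonoidAlgebra L L} (hu : u ≠ 0) (hev : expGroupAlgebraEval L u = 0) :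
    ∃ v : AddMonoidAlgebra L L, v ≠ 0 ∧ expGroupAlgebraEval L v = 0 ∧
      (∀ σ : L ≃ₐ[ℚ] L, coeffAct σ v = v) ∧ ∀ τ : L ≃ₐ[ℚ] L, expAct τ v = v := by
  set N : AddMonoidAlgebra L L := ∏ σ : L ≃ₐ[ℚ] L, coeffAct σ u with hN
  have hN0 : N ≠ 0 := Finset.prod_ne_zero_iff.2 fun σ _ => coeffAct_ne_zero σ hu
  have hNinv : ∀ σ : L ≃ₐ[ℚ] L, coeffAct σ N = N := by
    intro σ
    rw [hN, map_prod]
    simp_rw [← coeffAct_mul]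
    exact Fintype.prod_bijective (σ * ·) (Group.mulLeft_bijective σ) _ _ fun _ => rfl
  have hNev : expGroupAlgebraEval L N = 0 := by
    rw [hN, map_prod]
    refine Finset.prod_eq_zero (Finset.mem_univ 1) ?_
    rw [← hev]
    congr 1
    ext x
    exact coeff_coeffAct 1 u x
  refine ⟨∏ τ : L ≃ₐ[ℚ] L, expAct τ N,
    Finset.prod_ne_zero_iff.2 fun τ _ => expAct_ne_zero τ hN0, ?_, fun σ => ?_, fun τ => ?_⟩
  · rw [map_prod]
    refine Finset.prod_eq_zero (Finset.mem_univ 1) ?_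
    rw [← hNev]
    congr 1
    ext x
    exact coeff_expAct 1 N x
  · rw [map_prod]
    simp_rw [coeffAct_expAct, hNinv]
  · rw [map_prod]
    simp_rw [← expAct_mul]
    exact Fintype.prod_bijective (τ * ·) (Group.mulLeft_bijective τ) _ _ fun _ => rfl

theorem expGroupAlgebraEval_injective [IsGalois ℚ L] :
    Function.Injective (expGroupAlgebraEval L) := by
  classical
  rw [injective_iff_map_eq_zero]
  intro u hev
  by_contra hu
  obtain ⟨v, hv0, hvev, hvc, hve⟩ := exists_galois_invariant_of_expGroupAlgebraEval_eq_zero hu hev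
  have hvq : ∀ x, ∃ q : ℚ, algebraMap ℚ L q = v.coeff x := fun x =>
    (IsGalois.mem_range_algebraMap_iff_fixed (F := ℚ) _).2 fun σ => by
      conv_rhs => rw [← hvc σ]
      rfl
  choose q hq using hvq
  set v' : AddMonoidAlgebra L L :=
    AddMonoidAlgebra.mapDomainRingHom L (negAddMonoidHom : L →+ L) v with hv'
  have hv'c : ∀ x, v'.coeff x = v.coeff (-x) := by
    intro x
    have := Finsupp.mapDomain_apply (f := fun y : L => -y) neg_injective v.coeff (-x)
    rw [neg_neg] at this
    exact this
  set w := v * v' with hw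
  have hwc : ∀ x, w.coeff x = ∑ y ∈ v.coeff.support, v.coeff y * v.coeff (y - x) := by
    intro x
    rw [hw, AddMonoidAlgebra.coeff_mul]
    refine Finset.sum_congr rfl fun y _ => ?_
    simp only [Finsupp.sum]
    have h1 : ∀ z, (if y + z = x then v.coeff y * v'.coeff z else 0)
        = if x - y = z then v.coeff y * v.coeff (y - x) else 0 := by
      intro z
      by_cases h : y + z = x
      · subst h; simp [hv'c]
      · rw [if_neg h, if_neg]
        rintro rfl; exact h (by ring)
    simp_rw [h1]
    rw [Finset.sum_ite_eq]
    split_ifs with h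
    · rfl
    · rw [Finsupp.notMem_support_iff, hv'c, neg_sub] at h
      rw [h, mul_zero]
  have hwev : expGroupAlgebraEval L w = 0 := by rw [hw, map_mul, hvev, zero_mul]
  have hwq : ∀ x, w.coeff x = algebraMap ℚ L (∑ y ∈ v.coeff.support, q y * q (y - x)) := by
    intro x
    rw [hwc, map_sum]
    simp only [map_mul, hq]
  have hw0 : w.coeff 0 ≠ 0 := by
    rw [hwq, map_ne_zero]
    refine (Finset.sum_pos (fun y hy => ?_) ?_).ne'
    · rw [sub_zero]
      refine mul_self_pos.2 fun h => ?_
      rw [Finsupp.mem_support_iff, ← hq, h, map_zero] at hy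
      exact hy rfl
    · rw [Finsupp.support_nonempty_iff]
      exact fun h => hv0 (AddMonoidAlgebra.coeff_eq_zero.1 h)
  have hvτ : ∀ (τ : L ≃ₐ[ℚ] L) x, v.coeff (τ x) = v.coeff x := by
    intro τ x
    conv_lhs => rw [← hve τ]
    exact coeff_expAct τ v x
  have hwτ : ∀ (τ : L ≃ₐ[ℚ] L) x, w.coeff (τ x) = w.coeff x := by
    intro τ x
    rw [hwc, hwc]
    refine (Finset.sum_nbij τ (fun y hy => ?_) τ.injective.injOn (fun y hy => ?_)
      (fun y _ => ?_)).symm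
    · rwa [Finsupp.mem_support_iff, hvτ, ← Finsupp.mem_support_iff]
    · refine ⟨τ.symm y, ?_, by simp⟩
      rw [Finset.mem_coe, Finsupp.mem_support_iff, ← hvτ τ, AlgEquiv.apply_symm_apply]
      exact Finsupp.mem_support_iff.1 hy
    · rw [← map_sub, hvτ, hvτ]
  set r : L → ℚ := fun x => ∑ y ∈ v.coeff.support, q y * q (y - x) with hr
  obtain ⟨b, hb⟩ := IsLocalization.exist_integer_multiples_of_finset (nonZeroDivisors ℤ)
    ((insert 0 w.coeff.support).image r)
  have hbz : ∀ x, ∃ z : ℤ, (z : ℚ) = (b : ℤ) * r x := by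
    intro x
    by_cases hx : x ∈ w.coeff.support
    · obtain ⟨z, hz⟩ := hb (r x) (Finset.mem_image_of_mem _ (Finset.mem_insert_of_mem hx))
      exact ⟨z, by simpa [zsmul_eq_mul] using hz⟩
    · refine ⟨0, ?_⟩
      rw [Finsupp.notMem_support_iff, hwq, map_eq_zero] at hx
      simp only [hr, hx]; simp
  choose z hz using hbz
  have hzw : ∀ x, (z x : L) = (b : ℤ) * w.coeff x := by
    intro x
    have := congrArg (algebraMap ℚ L) (hz x)
    rw [map_mul, map_intCast, map_intCast] at this
    rw [hwq]
    exact this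
  have hb0 : ((b : ℤ) : L) ≠ 0 := by
    rw [Int.cast_ne_zero]; exact nonZeroDivisors.ne_zero b.2
  refine not_galois_invariant_exp_relation (w.coeff.support.erase 0) z
    (Finset.notMem_erase _ _) (fun τ x hx => ?_) (fun τ x => ?_) ?_ ?_
  · rw [Finset.mem_erase, Finsupp.mem_support_iff] at hx ⊢
    rw [hwτ]
    exact ⟨fun h => hx.1 ((map_eq_zero τ).1 h), hx.2⟩
  · have : (z (τ x) : L) = z x := by rw [hzw, hzw, hwτ]
    exact_mod_cast this
  · intro h
    have := hzw 0
    rw [h, Int.cast_zero] at this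
    exact mul_ne_zero hb0 hw0 this.symm
  · have h0 : (0 : L) ∈ w.coeff.support := Finsupp.mem_support_iff.2 hw0
    have h1 := expGroupAlgebraEval_apply w
    rw [hwev, ← Finset.add_sum_erase _ _ h0, (algebraMap L ℂ).map_zero,
      Complex.exp_zero, mul_one] at h1
    have h2 : ∀ x, (z x : ℂ) = ((b : ℤ) : ℂ) * algebraMap L ℂ (w.coeff x) := by
      intro x
      have := congrArg (algebraMap L ℂ) (hzw x)
      simpa using this
    simp_rw [h2, mul_assoc]
    rw [← Finset.mul_sum, ← mul_add, ← h1, mul_zero]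

end

/-- **Lindemann–Weierstrass** for real algebraic numbers. -/
theorem lindemann_weierstrass_real {ι : Type*} (s : Finset ι) (c α : ι → ℝ)
    (hc : ∀ i ∈ s, IsAlgebraic ℚ (c i)) (hα : ∀ i ∈ s, IsAlgebraic ℚ (α i))
    (hinj : Set.InjOn α s) (h : ∑ i ∈ s, c i * Real.exp (α i) = 0) :
    ∀ i ∈ s, c i = 0 := by
  classical
  have hcC : ∀ i ∈ s, IsAlgebraic ℚ (c i : ℂ) := fun i hi => (hc i hi).algebraMap
  have hαC : ∀ i ∈ s, IsAlgebraic ℚ (α i : ℂ) := fun i hi => (hα i hi).algebraMap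
  set F : IntermediateField ℚ ℂ := IntermediateField.adjoin ℚ
    (↑(s.image (fun i => (c i : ℂ)) ∪ s.image (fun i => (α i : ℂ))) : Set ℂ) with hF
  have hFfin : FiniteDimensional ℚ F := by
    refine IntermediateField.finiteDimensional_adjoin fun x hx => ?_
    rw [Finset.mem_coe, Finset.mem_union, Finset.mem_image, Finset.mem_image] at hx
    rcases hx with ⟨i, hi, rfl⟩ | ⟨i, hi, rfl⟩
    · exact (hcC i hi).isIntegral
    · exact (hαC i hi).isIntegral
  set L : IntermediateField ℚ ℂ := IntermediateField.normalClosure ℚ F ℂ with hL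
  have hFL : F ≤ L := F.le_normalClosure
  have hcL : ∀ i ∈ s, (c i : ℂ) ∈ L := fun i hi =>
    hFL (IntermediateField.subset_adjoin _ _ (Finset.mem_coe.2 (Finset.mem_union_left _
      (Finset.mem_image_of_mem (fun i => (c i : ℂ)) hi))))
  have hαL : ∀ i ∈ s, (α i : ℂ) ∈ L := fun i hi =>
    hFL (IntermediateField.subset_adjoin _ _ (Finset.mem_coe.2 (Finset.mem_union_right _
      (Finset.mem_image_of_mem (fun i => (α i : ℂ)) hi))))
  have hLfin : FiniteDimensional ℚ L := normalClosure.is_finiteDimensional ℚ F ℂ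
  have hgal : IsGalois ℚ L := isGalois_iff.2 ⟨inferInstance,
    (Algebra.IsAlgebraic.isNormalClosure_normalClosure (F := ℚ) (K := F) (L := ℂ)
      fun _ => IsAlgClosed.splits _).normal⟩
  set u : AddMonoidAlgebra L L := ∑ i ∈ s.attach,
    AddMonoidAlgebra.single (⟨α i, hαL i i.2⟩ : L) (⟨c i, hcL i i.2⟩ : L) with hu
  have hu0 : u = 0 := by
    refine expGroupAlgebraEval_injective ?_
    rw [map_zero, hu, map_sum]
    have : ∀ i ∈ s.attach, expGroupAlgebraEval L (AddMonoidAlgebra.single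
        (⟨α i, hαL i i.2⟩ : L) (⟨c i, hcL i i.2⟩ : L)) = ((c i * Real.exp (α i) : ℝ) : ℂ) := by
      intro i _
      rw [expGroupAlgebraEval, AddMonoidAlgebra.lift_single, Algebra.smul_def]
      push_cast
      rfl
    rw [Finset.sum_congr rfl this, ← Complex.ofReal_sum,
      Finset.sum_attach s (fun i => c i * Real.exp (α i)), h, Complex.ofReal_zero]
  intro i hi
  have h1 : u.coeff ⟨α i, hαL i hi⟩ = (⟨c i, hcL i hi⟩ : L) := by
    rw [hu, AddMonoidAlgebra.coeff_sum, Finset.sum_apply']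
    rw [Finset.sum_eq_single ⟨i, hi⟩]
    · simp
    · intro j _ hj
      rw [AddMonoidAlgebra.coeff_single, Finsupp.single_apply, if_neg]
      intro h
      exact hj (Subtype.ext (hinj j.2 hi (Complex.ofReal_injective (congrArg Subtype.val h))))
    · intro h; exact absurd (Finset.mem_attach _ _) h
  rw [hu0] at h1
  exact Complex.ofReal_injective (congrArg Subtype.val h1).symm

section ExpZeros

open Filter Topology

lemma continuousLinear_removeNth {m : ℕ} (i : Fin (m + 1)) :
    Continuous (fun x : Fin (m + 1) → ℝ => i.removeNth x) :=
  continuous_pi fun j => continuous_apply (i.succAbove j)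

lemma exists_analytic_graph_of_fderiv_ne_zero {m : ℕ} {h : (Fin (m + 1) → ℝ) → ℝ}
    {y : Fin (m + 1) → ℝ} {i : Fin (m + 1)} (hh : AnalyticAt ℝ h y) (hy : h y = 0)
    (hd : fderiv ℝ h y (Pi.single i 1) ≠ 0) :
    ∃ γ : (Fin m → ℝ) → (Fin (m + 1) → ℝ), AnalyticAt ℝ γ (i.removeNth y) ∧
      γ (i.removeNth y) = y ∧ (∀ᶠ w in 𝓝 (i.removeNth y), i.removeNth (γ w) = w) ∧
      ∀ᶠ x in 𝓝 y, h x = 0 → x = γ (i.removeNth x) := by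
  classical
  set e : Fin (m + 1) → ℝ := Pi.single i 1 with he
  set Φ : (Fin (m + 1) → ℝ) → (Fin (m + 1) → ℝ) := fun x => x + (h x - x i) • e with hΦ
  have hΦrem : ∀ x, i.removeNth (Φ x) = i.removeNth x := by
    intro x
    ext j
    simp [hΦ, he, Fin.removeNth, Fin.succAbove_ne]
  have hΦi : ∀ x, Φ x i = h x := by
    intro x
    simp [hΦ, he]
  have hΦeq : ∀ x, Φ x = i.insertNth (α := fun _ => ℝ) (h x) (i.removeNth x) := by
    intro x
    rw [← hΦrem, ← hΦi, Fin.insertNth_self_removeNth]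
  have hΦan : AnalyticAt ℝ Φ y := by
    refine analyticAt_id.add ((hh.sub ?_).smul analyticAt_const)
    exact (ContinuousLinearMap.proj (R := ℝ) (φ := fun _ : Fin (m + 1) => ℝ) i).analyticAt y
  set A : (Fin (m + 1) → ℝ) →L[ℝ] (Fin (m + 1) → ℝ) :=
    ContinuousLinearMap.id ℝ _ + (fderiv ℝ h y -
      ContinuousLinearMap.proj (R := ℝ) (φ := fun _ : Fin (m + 1) => ℝ) i).smulRight e with hA
  have hΦd : HasFDerivAt Φ A y := by
    refine (hasFDerivAt_id y).add ((hh.differentiableAt.hasFDerivAt.sub ?_).smul_const e)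
    exact (ContinuousLinearMap.proj (R := ℝ) (φ := fun _ : Fin (m + 1) => ℝ) i).hasFDerivAt
  have hinj : Function.Injective (A : (Fin (m + 1) → ℝ) →ₗ[ℝ] (Fin (m + 1) → ℝ)) := by
    rw [injective_iff_map_eq_zero]
    intro v hv
    have hv' : v + (fderiv ℝ h y v - v i) • e = 0 := hv
    have hi : fderiv ℝ h y v = 0 := by
      have := congrFun hv' i
      simpa [he] using this
    have hve : v = v i • e := by
      rw [hi, zero_sub, neg_smul, ← sub_eq_add_neg, sub_eq_zero] at hv'
      exact hv'
    rw [hve, map_smul, smul_eq_mul, mul_eq_zero] at hi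
    rw [hve, hi.resolve_right hd, zero_smul]
  set A' : (Fin (m + 1) → ℝ) ≃L[ℝ] (Fin (m + 1) → ℝ) :=
    (LinearEquiv.ofInjectiveEndo _ hinj).toContinuousLinearEquiv with hA'
  have hAA' : (A' : (Fin (m + 1) → ℝ) →L[ℝ] (Fin (m + 1) → ℝ)) = A := by
    ext v : 1
    rfl
  rw [← hAA'] at hΦd
  have hΦc : ContDiffAt ℝ ⊤ Φ y := hΦan.contDiffAt
  have hΦs : HasStrictFDerivAt Φ (A' : (Fin (m + 1) → ℝ) →L[ℝ] (Fin (m + 1) → ℝ)) y :=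
    hΦc.hasStrictFDerivAt' hΦd (by simp)
  set ψ := hΦs.localInverse Φ A' y with hψ
  have hψan : AnalyticAt ℝ ψ (Φ y) :=
    (hΦc.to_localInverse hΦd (by simp)).analyticAt
  set J : (Fin m → ℝ) → (Fin (m + 1) → ℝ) := fun w => i.insertNth (α := fun _ => ℝ) 0 w with hJ
  have hJan : ∀ w, AnalyticAt ℝ J w := by
    intro w
    rw [analyticAt_pi_iff]
    intro j
    induction j using i.succAboveCases with
    | x => simpa [hJ] using analyticAt_const
    | p j =>
      simp only [Fin.insertNth_apply_succAbove]
      exact (ContinuousLinearMap.proj (R := ℝ) (φ := fun _ : Fin m => ℝ) j).analyticAt w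
  have hJy : J (i.removeNth y) = Φ y := by rw [hΦeq, hy]
  refine ⟨ψ ∘ J, ?_, ?_, ?_, ?_⟩
  · exact AnalyticAt.comp (by rw [hJy]; exact hψan) (hJan _)
  · rw [Function.comp_apply, hJy]
    exact hΦs.localInverse_apply_image
  · have h1 := hΦs.eventually_right_inverse
    rw [← hJy] at h1
    filter_upwards [(hJan (i.removeNth y)).continuousAt.eventually h1] with w hw
    have h2 := hΦrem (ψ (J w))
    rw [hw] at h2
    rw [Function.comp_apply, ← h2, hJ, Fin.removeNth_insertNth]
  · filter_upwards [hΦs.eventually_left_inverse] with x hx h0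
    rw [Function.comp_apply]
    rw [hΦeq, h0] at hx
    exact hx.symm

/-- A function analytic at `x` that is not locally zero there has a last vanishing iterated
derivative. -/
lemma exists_iteratedFDeriv_eq_zero_fderiv_ne_zero {E : Type*} [NormedAddCommGroup E]
    [NormedSpace ℝ E] {f : E → ℝ} {x : E} (hf : AnalyticAt ℝ f x) (hx : f x = 0)
    (hne : ¬ ∀ᶠ y in 𝓝 x, f y = 0) :
    ∃ j, iteratedFDeriv ℝ j f x = 0 ∧ fderiv ℝ (iteratedFDeriv ℝ j f) x ≠ 0 := by
  by_contra! H
  have h0 : ∀ j, iteratedFDeriv ℝ j f x = 0 := by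
    intro j
    induction j with
    | zero => rw [iteratedFDeriv_zero_eq_comp, Function.comp_apply, hx, map_zero]
    | succ j ih =>
      ext v
      rw [iteratedFDeriv_succ_apply_left, H j ih]
      rfl
  obtain ⟨p, r, hp⟩ := hf
  refine hne ?_
  filter_upwards [hp.eventually_hasSum_sub] with y hy
  refine hy.unique ?_
  convert hasSum_zero with j
  have := hp.factorial_smul (y - x) j
  rw [h0] at this
  exact (smul_eq_zero.1 this).resolve_left j.factorial_ne_zero

/-- Near a zero where its derivative does not vanish, the zero set of an analytic map is
contained in an analytic graph over a coordinate hyperplane. -/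
lemma exists_analytic_graph_of_analyticAt {m : ℕ} {G : Type*} [NormedAddCommGroup G]
    [NormedSpace ℝ G] {H : (Fin (m + 1) → ℝ) → G} {x : Fin (m + 1) → ℝ}
    (hH : AnalyticAt ℝ H x) (hx : H x = 0) (hd : fderiv ℝ H x ≠ 0) :
    ∃ (i : Fin (m + 1)) (γ : (Fin m → ℝ) → (Fin (m + 1) → ℝ)),
      AnalyticAt ℝ γ (i.removeNth x) ∧ γ (i.removeNth x) = x ∧
      (∀ᶠ w in 𝓝 (i.removeNth x), i.removeNth (γ w) = w) ∧
      ∀ᶠ x' in 𝓝 x, H x' = 0 → x' = γ (i.removeNth x') := by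
  classical
  obtain ⟨i, hi⟩ : ∃ i, fderiv ℝ H x (Pi.single i 1) ≠ 0 := by
    by_contra! h
    refine hd (ContinuousLinearMap.coe_injective ?_)
    refine LinearMap.pi_ext' fun i => LinearMap.ext_ring ?_
    simpa using h i
  obtain ⟨l, hl⟩ := SeparatingDual.exists_ne_zero (R := ℝ) hi
  have hlH : AnalyticAt ℝ (fun z => l (H z)) x := (l.analyticAt (H x)).comp hH
  have hfd : fderiv ℝ (fun z => l (H z)) x = l.comp (fderiv ℝ H x) :=
    (l.hasFDerivAt.comp x hH.differentiableAt.hasFDerivAt).fderiv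
  obtain ⟨γ, h1, h2, h3, h4⟩ := exists_analytic_graph_of_fderiv_ne_zero (i := i) hlH
    (by rw [hx, map_zero]) (by rw [hfd]; exact hl)
  refine ⟨i, γ, h1, h2, h3, ?_⟩
  filter_upwards [h4] with z hz h0
  exact hz (by rw [h0, map_zero])

lemma dimH_le_of_forall_nhdsWithin {X : Type*} [EMetricSpace X] [SecondCountableTopology X]
    {s : Set X} {d : ℝ≥0∞} (h : ∀ x ∈ s, ∃ t ∈ 𝓝[s] x, dimH t ≤ d) : dimH s ≤ d := by
  by_contra! hlt
  obtain ⟨x, hx, hxt⟩ := exists_mem_nhdsWithin_lt_dimH_of_lt_dimH hlt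
  obtain ⟨t, ht, htd⟩ := h x hx
  exact (hxt t ht).not_ge htd

/-- Covering a zero set by the pieces on which a given iterated derivative vanishes
nondegenerately. -/
lemma subset_iUnion_iteratedFDeriv {E : Type*} [NormedAddCommGroup E]
    [NormedSpace ℝ E] {f : E → ℝ} {s : Set E} (hf : AnalyticOnNhd ℝ f s)
    (hs : ∀ x ∈ s, f x = 0) (hne : ∀ x ∈ s, ¬ ∀ᶠ y in 𝓝 x, f y = 0) :
    s ⊆ ⋃ j, s ∩ {x | iteratedFDeriv ℝ j f x = 0 ∧ fderiv ℝ (iteratedFDeriv ℝ j f) x ≠ 0} := by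
  intro x hx
  obtain ⟨j, hj⟩ := exists_iteratedFDeriv_eq_zero_fderiv_ne_zero (hf x hx) (hs x hx) (hne x hx)
  exact mem_iUnion.2 ⟨j, hx, hj⟩

lemma dimH_zeros_le {k : ℕ} {f : (Fin (k + 1) → ℝ) → ℝ} {s : Set (Fin (k + 1) → ℝ)}
    (hf : AnalyticOnNhd ℝ f s) (hs : ∀ x ∈ s, f x = 0)
    (hne : ∀ x ∈ s, ¬ ∀ᶠ y in 𝓝 x, f y = 0) : dimH s ≤ k := by
  refine (dimH_mono (subset_iUnion_iteratedFDeriv hf hs hne)).trans ?_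
  rw [dimH_iUnion]
  refine iSup_le fun j => dimH_le_of_forall_nhdsWithin fun x hx => ?_
  obtain ⟨i, γ, hγ, -, -, hgraph⟩ := exists_analytic_graph_of_analyticAt
    (hf.iteratedFDeriv j x hx.1) hx.2.1 hx.2.2
  obtain ⟨ε, hε, hball⟩ := Metric.eventually_nhds_iff_ball.1 hγ.eventually_analyticAt
  have hev : ∀ᶠ x' in 𝓝 x, (i.removeNth x' : Fin k → ℝ) ∈ Metric.ball (i.removeNth x) ε :=
    (continuousLinear_removeNth i).continuousAt.eventually (Metric.ball_mem_nhds _ hε)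
  refine ⟨γ '' Metric.ball (i.removeNth x) ε, ?_, ?_⟩
  · filter_upwards [nhdsWithin_le_nhds hev, nhdsWithin_le_nhds hgraph, self_mem_nhdsWithin]
      with z h1 h2 h3
    exact ⟨_, h1, (h2 h3.2.1).symm⟩
  · have hγc : ContDiffOn ℝ 1 γ (Metric.ball (i.removeNth x) ε) :=
      fun w hw => (hball w hw).contDiffAt.contDiffWithinAt
    refine (hγc.dimH_image_le (convex_ball _ _) subset_rfl).trans ?_
    exact (dimH_mono (subset_univ _)).trans_eq (Real.dimH_univ_pi_fin k)

lemma not_eventually_eq_zero_of_preconnected {E : Type*} [NormedAddCommGroup E]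
    [NormedSpace ℝ E] {f : E → ℝ} {s : Set E} (hf : AnalyticOnNhd ℝ f s) (hs : IsPreconnected s)
    {x : E} (hx : x ∈ s) (hne : ∃ y ∈ s, f y ≠ 0) : ¬ ∀ᶠ y in 𝓝 x, f y = 0 := by
  intro h
  obtain ⟨y, hy, hfy⟩ := hne
  exact hfy (hf.eqOn_of_preconnected_of_eventuallyEq (g := fun _ => (0 : ℝ))
    (fun _ _ => analyticAt_const) hs hx h hy)

/-- If the zero set of an analytic function has full codimension-one dimension in an open set,
then it contains there an analytic graph over an open subset of a coordinate hyperplane. -/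
lemma exists_analytic_graph_subset_zeros {m : ℕ} {F : (Fin (m + 1) → ℝ) → ℝ}
    (hF : AnalyticOnNhd ℝ F univ) (hne : ∃ y, F y ≠ 0) {U : Set (Fin (m + 1) → ℝ)}
    (hU : ({x | F x = 0} ∩ U).Nonempty) (hdim : (m : ℝ≥0∞) ≤ dimH ({x | F x = 0} ∩ U)) :
    ∃ (i : Fin (m + 1)) (w₀ : Fin m → ℝ) (γ : (Fin m → ℝ) → (Fin (m + 1) → ℝ)),
      AnalyticAt ℝ γ w₀ ∧ γ w₀ ∈ U ∧ (∀ᶠ w in 𝓝 w₀, i.removeNth (γ w) = w) ∧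
      ∀ᶠ w in 𝓝 w₀, F (γ w) = 0 := by
  have hne' : ∀ x, ¬ ∀ᶠ y in 𝓝 x, F y = 0 := fun x =>
    not_eventually_eq_zero_of_preconnected hF isPreconnected_univ (mem_univ x)
      (hne.imp fun y hy => ⟨mem_univ y, hy⟩)
  cases m with
  | zero =>
    obtain ⟨x, hx, hxU⟩ := hU
    exact ⟨0, Fin.elim0, fun _ => x, analyticAt_const, hxU,
      Eventually.of_forall fun _ => Subsingleton.elim _ _, Eventually.of_forall fun _ => hx⟩
  | succ k =>
    have hlt : (k : ℝ≥0∞) < dimH ({x | F x = 0} ∩ U) :=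
      lt_of_lt_of_le (by exact_mod_cast Nat.lt_succ_self k) hdim
    have hcov := dimH_mono (subset_iUnion_iteratedFDeriv (f := F) (s := {x | F x = 0} ∩ U)
      (fun x _ => hF x (mem_univ x)) (fun x hx => hx.1) (fun x _ => hne' x))
    rw [dimH_iUnion] at hcov
    obtain ⟨j, hj⟩ := lt_iSup_iff.1 (hlt.trans_le hcov)
    obtain ⟨x, hx, hxt⟩ := exists_mem_nhdsWithin_lt_dimH_of_lt_dimH hj
    obtain ⟨i, γ, hγ, hγx, hrem, hgraph⟩ := exists_analytic_graph_of_analyticAt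
      (hF.iteratedFDeriv j x (mem_univ x)) hx.2.1 hx.2.2
    refine ⟨i, i.removeNth x, γ, hγ, by rw [hγx]; exact hx.1.2, hrem, ?_⟩
    by_contra hcon
    obtain ⟨ε, hε, hball⟩ := Metric.eventually_nhds_iff_ball.1 hγ.eventually_analyticAt
    set D := Metric.ball (i.removeNth x : Fin (k + 1) → ℝ) ε with hD
    have hFγ : AnalyticOnNhd ℝ (fun w => F (γ w)) D := fun w hw =>
      (hF (γ w) (mem_univ _)).comp (hball w hw)
    have hconD : ∃ w ∈ D, F (γ w) ≠ 0 := by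
      by_contra! h
      exact hcon (eventually_of_mem (Metric.ball_mem_nhds _ hε) h)
    have hdimZ : dimH {w ∈ D | F (γ w) = 0} ≤ k :=
      dimH_zeros_le (fun w hw => hFγ w hw.1) (fun w hw => hw.2) fun w hw =>
        not_eventually_eq_zero_of_preconnected hFγ (convex_ball _ _).isPreconnected hw.1 hconD
    have hγc : ContDiffOn ℝ 1 γ D :=
      fun w hw => (hball w hw).contDiffAt.contDiffWithinAt
    refine (hxt (γ '' {w ∈ D | F (γ w) = 0}) ?_).not_ge
      ((hγc.dimH_image_le (convex_ball _ _) fun w hw => hw.1).trans hdimZ)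
    have hev : ∀ᶠ x' in 𝓝 x, (i.removeNth x' : Fin (k + 1) → ℝ) ∈ D :=
      (continuousLinear_removeNth i).continuousAt.eventually (Metric.ball_mem_nhds _ hε)
    filter_upwards [nhdsWithin_le_nhds hev, nhdsWithin_le_nhds hgraph, self_mem_nhdsWithin]
      with z h1 h2 h3
    have h4 := h2 h3.2.1
    refine ⟨_, ⟨h1, ?_⟩, h4.symm⟩
    rw [← h4]
    exact h3.1.1

/-- A set containing the graph of a map over a neighbourhood in a coordinate hyperplane has local
dimension at least that of the hyperplane. -/
lemma le_dimH_inter_ball_of_graph {m : ℕ} {i : Fin (m + 1)} {A : Set (Fin (m + 1) → ℝ)}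
    {γ : (Fin m → ℝ) → (Fin (m + 1) → ℝ)} {w : Fin m → ℝ} (hγ : ContinuousAt γ w)
    (hrem : ∀ᶠ w' in 𝓝 w, i.removeNth (γ w') = w') (hA : ∀ᶠ w' in 𝓝 w, γ w' ∈ A)
    {ε : ℝ} (hε : 0 < ε) : (m : ℝ≥0∞) ≤ dimH (A ∩ Metric.ball (γ w) ε) := by
  have hL : LipschitzWith 1 (fun x : Fin (m + 1) → ℝ => (i.removeNth x : Fin m → ℝ)) :=
    LipschitzWith.of_dist_le_mul fun x y => by
      rw [NNReal.coe_one, one_mul, dist_pi_le_iff dist_nonneg]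
      exact fun j => dist_le_pi_dist x y (i.succAbove j)
  refine le_trans ?_ (hL.dimH_image_le (A ∩ Metric.ball (γ w) ε))
  have hmem : (fun x : Fin (m + 1) → ℝ => (i.removeNth x : Fin m → ℝ)) ''
      (A ∩ Metric.ball (γ w) ε) ∈ 𝓝 w := by
    filter_upwards [hrem, hA, hγ.eventually (Metric.ball_mem_nhds _ hε)] with w' h1 h2 h3
    exact ⟨γ w', ⟨h2, h3⟩, h1⟩
  rw [Real.dimH_of_mem_nhds hmem, Module.finrank_fin_fun]

lemma Polynomial.dvd_of_mem_of_irreducible_mem {R : Type*} [CommRing R] [IsDomain R]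
    [UniqueFactorizationMonoid R] {J : Ideal (Polynomial R)}
    (hJ : ∀ r : R, Polynomial.C r ∈ J → r = 0) {q p : Polynomial R} (hq : Irreducible q)
    (hqJ : q ∈ J) (hpJ : p ∈ J) : q ∣ p := by
  have hdeg : q.natDegree ≠ 0 := by
    intro h
    have h1 := Polynomial.eq_C_of_natDegree_eq_zero h
    rw [h1] at hqJ
    rw [hJ _ hqJ, map_zero] at h1
    exact hq.ne_zero h1
  have hprim : q.IsPrimitive := hq.isPrimitive hdeg
  set F := FractionRing R
  rw [hprim.dvd_iff_fraction_map_dvd_fraction_map F]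
  have hirr := (hprim.irreducible_iff_irreducible_map_fraction_map (K := F)).1 hq
  by_contra hnd
  obtain ⟨a, c, hac⟩ := hirr.coprime_iff_not_dvd.2 hnd
  obtain ⟨b₁, hb₁, ha⟩ := IsLocalization.integerNormalization_spec (nonZeroDivisors R) a
  obtain ⟨b₂, hb₂, hc⟩ := IsLocalization.integerNormalization_spec (nonZeroDivisors R) c
  set a' := IsLocalization.integerNormalization (nonZeroDivisors R) a
  set c' := IsLocalization.integerNormalization (nonZeroDivisors R) c
  have h : Polynomial.C b₂ * a' * q + Polynomial.C b₁ * c' * p = Polynomial.C (b₁ * b₂) := by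
    refine Polynomial.map_injective (algebraMap R F) (IsFractionRing.injective R F) ?_
    simp only [Polynomial.map_add, Polynomial.map_mul, Polynomial.map_C, ha, hc, map_mul,
      Algebra.smul_def, Polynomial.algebraMap_apply]
    linear_combination (Polynomial.C (algebraMap R F b₁) * Polynomial.C (algebraMap R F b₂)) * hac
  have h0 := hJ (b₁ * b₂) (h ▸ J.add_mem (J.mul_mem_left _ hqJ) (J.mul_mem_left _ hpJ))
  exact mul_ne_zero (nonZeroDivisors.ne_zero hb₁) (nonZeroDivisors.ne_zero hb₂) h0

lemma MvPolynomial.dvd_of_mem_of_irreducible_mem {σ k : Type*} [Field k]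
    {J : Ideal (MvPolynomial σ k)} (s : σ)
    (hJ : ∀ r : MvPolynomial {j // j ≠ s} k, rename Subtype.val r ∈ J → r = 0)
    {q p : MvPolynomial σ k} (hq : Irreducible q) (hqJ : q ∈ J) (hpJ : p ∈ J) : q ∣ p := by
  classical
  set φ : MvPolynomial σ k ≃ₐ[k] Polynomial (MvPolynomial {j // j ≠ s} k) :=
    (renameEquiv k (Equiv.optionSubtypeNe s).symm).trans (optionEquivLeft k _) with hφ
  have hφC : ∀ r : MvPolynomial {j // j ≠ s} k, φ (rename Subtype.val r) = Polynomial.C r := by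
    intro r
    have : (φ : MvPolynomial σ k →ₐ[k] _).comp (rename Subtype.val) =
        (Algebra.ofId (MvPolynomial {j // j ≠ s} k) (Polynomial (MvPolynomial {j // j ≠ s} k))
          ).restrictScalars k := by
      refine algHom_ext fun j => ?_
      have hj : (j : σ) ≠ s := j.2
      simp [hφ, optionEquivLeft_X_some, Algebra.ofId_apply, hj]
    exact DFunLike.congr_fun this r
  rw [← map_dvd_iff φ]
  refine Polynomial.dvd_of_mem_of_irreducible_mem (J := J.comap (φ.symm : _ →+* _))
    (fun r hr => hJ r ?_) ((MulEquiv.irreducible_iff φ).2 hq) ?_ ?_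
  · rw [← hφC] at hr
    simpa using hr
  · simpa using hqJ
  · simpa using hpJ

lemma exists_map_eq_of_coeffsIn {σ : Type*} {K : Subfield ℝ} {P : MvPolynomial σ ℝ}
    (hP : CoeffsIn K P) : ∃ Q : MvPolynomial σ K, MvPolynomial.map (algebraMap K ℝ) Q = P := by
  have : P ∈ Set.range (MvPolynomial.map (algebraMap K ℝ)) := by
    rw [MvPolynomial.mem_range_map_iff_coeffs_subset]
    intro c hc
    obtain ⟨m, -, rfl⟩ := MvPolynomial.mem_coeffs_iff.1 hc
    exact ⟨⟨_, hP m⟩, rfl⟩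
  exact this

lemma coeffsIn_map {σ : Type*} (K : Subfield ℝ) (Q : MvPolynomial σ K) :
    CoeffsIn K (MvPolynomial.map (algebraMap K ℝ) Q) := fun m => by
  rw [MvPolynomial.coeff_map]
  exact (Q.coeff m).2

lemma eval_map_eq_aeval {σ : Type*} {K : Subfield ℝ} (z : σ → ℝ) (Q : MvPolynomial σ K) :
    MvPolynomial.eval z (MvPolynomial.map (algebraMap K ℝ) Q) = MvPolynomial.aeval z Q := by
  rw [MvPolynomial.eval_map, MvPolynomial.aeval_def]

lemma isPrime_vanishingIdeal_of_isIrredAlgSet {σ : Type*} {K : Subfield ℝ} {Z : Set (σ → ℝ)}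
    (hZ : IsIrredAlgSet K Z) : (MvPolynomial.vanishingIdeal K Z).IsPrime := by
  obtain ⟨⟨P, hP, hZP⟩, ⟨z, hz⟩, hirr⟩ := hZ
  obtain ⟨Q, rfl⟩ := exists_map_eq_of_coeffsIn hP
  simp_rw [eval_map_eq_aeval] at hZP
  have key : ∀ f : MvPolynomial σ K,
      IsAlgSet K {z | z ∈ Z ∧ MvPolynomial.aeval z f = 0} := by
    intro f
    refine ⟨_, coeffsIn_map K (Q * Q + f * f), ?_⟩
    ext z
    simp only [eval_map_eq_aeval, hZP, mem_ofPred_eq, map_add, map_mul,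
      mul_self_add_mul_self_eq_zero]
  refine ⟨fun h => ?_, fun {f g} hfg => ?_⟩
  · have := (MvPolynomial.mem_vanishingIdeal_iff.1 ((Ideal.eq_top_iff_one _).1 h)) z hz
    rw [map_one] at this
    exact one_ne_zero this
  · by_contra! hcon
    refine hirr ⟨_, _, key f, key g, ?_, ?_, ?_⟩
    · ext z
      have := fun hz => MvPolynomial.mem_vanishingIdeal_iff.1 hfg z hz
      simp only [map_mul, mul_eq_zero] at this
      simp only [mem_union, mem_ofPred_eq]
      tauto
    · refine ⟨fun z hz => hz.1, fun h => hcon.1 fun z hz => (h hz).2⟩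
    · refine ⟨fun z hz => hz.1, fun h => hcon.2 fun z hz => (h hz).2⟩

/-- A nonzero prime ideal contained in an ideal meeting the polynomials free of one variable
trivially is equal to it. -/
lemma le_of_isPrime_of_le {σ k : Type*} [Field k] {I J : Ideal (MvPolynomial σ k)} [I.IsPrime]
    (hI : I ≠ ⊥) (hIJ : I ≤ J) (s : σ)
    (hJ : ∀ r : MvPolynomial {j // j ≠ s} k, MvPolynomial.rename Subtype.val r ∈ J → r = 0) :
    J ≤ I := by
  obtain ⟨q, hqI, hq⟩ := Ideal.IsPrime.exists_mem_prime_of_ne_bot (I := I) inferInstance hI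
  intro p hp
  exact I.mem_of_dvd (MvPolynomial.dvd_of_mem_of_irreducible_mem s hJ hq.irreducible
    (hIJ hqI) hp) hqI

lemma eval_sumElim_eq_sum_fiberwise {n : ℕ} (Q : MvPolynomial (Fin n ⊕ Fin n) ℝ)
    (a u : Fin n → ℝ) :
    MvPolynomial.eval (Sum.elim a u) Q =
      ∑ d ∈ Q.support.image (fun m i => m (Sum.inr i)),
        (∑ m ∈ Q.support with (fun i => m (Sum.inr i)) = d,
          Q.coeff m * ∏ i, a i ^ m (Sum.inl i)) * ∏ i, u i ^ d i := by
  classical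
  rw [MvPolynomial.eval_eq', ← Finset.sum_fiberwise_of_maps_to
    (g := fun (m : (Fin n ⊕ Fin n) →₀ ℕ) i => m (Sum.inr i))
    (t := Q.support.image (fun m i => m (Sum.inr i)))
    (fun m hm => Finset.mem_image_of_mem _ hm)]
  refine Finset.sum_congr rfl fun d _ => ?_
  rw [Finset.sum_mul]
  refine Finset.sum_congr rfl fun m hm => ?_
  rw [← (Finset.mem_filter.1 hm).2, Fintype.prod_sum_type, mul_assoc]
  simp

/-- At an algebraic point outside `WP Q`, vanishing of the E-polynomial of `Q` forces `Q` to
vanish on the whole fibre. -/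
lemma eval_sumElim_eq_zero_of_expEval_eq_zero {n : ℕ} {Q : MvPolynomial (Fin n ⊕ Fin n) ℝ}
    (hQ : ∀ m, IsAlgebraic ℚ (Q.coeff m)) {a : Fin n → ℝ} (ha : ∀ i, IsAlgebraic ℚ (a i))
    (haW : a ∉ WP Q) (h0 : expEval Q a = 0) (u : Fin n → ℝ) :
    MvPolynomial.eval (Sum.elim a u) Q = 0 := by
  classical
  have hmem : ∀ {d}, d ∈ Q.support.image (fun m i => m (Sum.inr i)) → d ∈ Uexps Q := by
    intro d hd
    obtain ⟨m, hm, rfl⟩ := Finset.mem_image.1 hd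
    exact ⟨m, hm, rfl⟩
  have hexp : ∀ d : Fin n → ℕ,
      ∏ i, Real.exp (a i) ^ d i = Real.exp (∑ i, (d i : ℝ) * a i) := by
    intro d
    rw [Real.exp_sum]
    exact Finset.prod_congr rfl fun i _ => (Real.exp_nat_mul _ _).symm
  rw [expEval, eval_sumElim_eq_sum_fiberwise] at h0
  simp_rw [hexp] at h0
  have := lindemann_weierstrass_real _ _ _ (fun d _ => ?_) (fun d _ => ?_) ?_ h0
  · rw [eval_sumElim_eq_sum_fiberwise]
    exact Finset.sum_eq_zero fun d hd => by rw [this d hd, zero_mul]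
  · rw [← mem_algebraicClosure_iff]
    refine sum_mem fun m _ => ?_
    exact mul_mem (mem_algebraicClosure_iff.2 (hQ m))
      (prod_mem fun i _ => pow_mem (mem_algebraicClosure_iff.2 (ha i)) _)
  · rw [← mem_algebraicClosure_iff]
    refine sum_mem fun i _ => ?_
    exact mul_mem (natCast_mem _ _) (mem_algebraicClosure_iff.2 (ha i))
  · intro d hd e he hde
    by_contra hne
    exact haW ⟨d, e, hmem hd, hmem he, hne, hde⟩

lemma MvPolynomial.eq_zero_of_eval_eq_zero_on_ball {σ : Type*} {b : MvPolynomial σ ℝ}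
    {y : σ → ℝ} {ε : ℝ} (hε : 0 < ε)
    (h : ∀ x, (∀ j, x j ∈ Metric.ball (y j) ε) → eval x b = 0) : b = 0 := by
  refine funext_set (fun j => Metric.ball (y j) ε) (fun j => ?_) fun x hx => ?_
  · exact infinite_of_mem_nhds (y j) (Metric.ball_mem_nhds _ hε)
  · rw [h x fun j => hx j (mem_univ j), map_zero]

/-- Over a graph contained in an algebraic hypersurface, points with algebraic coordinates are
dense. -/
lemma exists_isAlgebraic_graph {m : ℕ} {i : Fin (m + 1)} {b : MvPolynomial (Fin (m + 1)) ℝ}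
    (hb : ∀ d, IsAlgebraic ℚ (b.coeff d)) (hb0 : b ≠ 0) {O : Set (Fin m → ℝ)} (hO : IsOpen O)
    (hOne : O.Nonempty) {γ : (Fin m → ℝ) → (Fin (m + 1) → ℝ)}
    (hrem : ∀ w ∈ O, i.removeNth (γ w) = w) (hγ : ∀ w ∈ O, MvPolynomial.eval (γ w) b = 0) :
    ∃ w ∈ O, ∀ j, IsAlgebraic ℚ (γ w j) := by
  classical
  have hopen : IsOpen {x : Fin (m + 1) → ℝ | i.removeNth x ∈ O ∧ MvPolynomial.eval x b ≠ 0} :=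
    (hO.preimage (continuous_pi fun j => continuous_apply (i.succAbove j))).inter
      (isOpen_compl_singleton.preimage (MvPolynomial.continuous_eval b))
  have hne : {x : Fin (m + 1) → ℝ |
      i.removeNth x ∈ O ∧ MvPolynomial.eval x b ≠ 0}.Nonempty := by
    by_contra hem
    rw [not_nonempty_iff_eq_empty] at hem
    obtain ⟨w, hw⟩ := hOne
    obtain ⟨ε, hε, hball⟩ := Metric.isOpen_iff.1 hO w hw
    refine hb0 (MvPolynomial.eq_zero_of_eval_eq_zero_on_ball
      (y := i.insertNth (α := fun _ => ℝ) 0 w) hε fun x hx => ?_)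
    by_contra hxb
    have : x ∈ (∅ : Set (Fin (m + 1) → ℝ)) := hem ▸ ⟨hball ?_, hxb⟩
    · exact this
    · rw [Metric.mem_ball, dist_pi_lt_iff hε]
      intro j
      simpa [Fin.removeNth] using hx (i.succAbove j)
  obtain ⟨q, hqO, hqb⟩ := (DenseRange.piMap fun _ : Fin (m + 1) =>
    Rat.denseRange_cast (𝕜 := ℝ)).exists_mem_open hopen hne
  set w : Fin m → ℝ := i.removeNth (Pi.map (fun _ => Rat.cast) q : Fin (m + 1) → ℝ) with hw
  set L := algebraicClosure ℚ ℝ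
  obtain ⟨bL, rfl⟩ : b ∈ Set.range (MvPolynomial.map (algebraMap L ℝ)) := by
    rw [MvPolynomial.mem_range_map_iff_coeffs_subset]
    intro c hc
    obtain ⟨d, -, rfl⟩ := MvPolynomial.mem_coeffs_iff.1 hc
    exact ⟨⟨_, mem_algebraicClosure_iff.2 (hb d)⟩, rfl⟩
  have hwL : ∀ j, algebraMap L ℝ ((q (i.succAbove j) : ℚ) : L) = w j := fun j => by
    rw [map_ratCast]
    rfl
  set p : Polynomial L := MvPolynomial.aeval (i.insertNth (α := fun _ => Polynomial L) Polynomial.X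
    fun j => Polynomial.C ((q (i.succAbove j) : ℚ) : L)) bL with hp
  have hpe : ∀ t : ℝ, Polynomial.aeval t p =
      MvPolynomial.eval (i.insertNth (α := fun _ => ℝ) t w)
        (MvPolynomial.map (algebraMap L ℝ) bL) := by
    intro t
    rw [hp, MvPolynomial.comp_aeval_apply, MvPolynomial.eval_map, ← MvPolynomial.aeval_def]
    congr 2
    ext j
    induction j using i.succAboveCases with
    | x => simp
    | p j => rw [Fin.insertNth_apply_succAbove, Fin.insertNth_apply_succAbove,
        Polynomial.aeval_C, hwL]
  have hp0 : p ≠ 0 := by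
    intro h
    have h1 := hpe ((q i : ℚ) : ℝ)
    rw [h, map_zero] at h1
    refine hqb ?_
    refine Eq.trans ?_ h1.symm
    exact congrArg (fun x => MvPolynomial.eval x (MvPolynomial.map (algebraMap L ℝ) bL))
      (Fin.insertNth_self_removeNth i (Pi.map (fun _ => Rat.cast) q : Fin (m + 1) → ℝ)).symm
  have hγw : i.insertNth (α := fun _ => ℝ) (γ w i) w = γ w := by
    have h1 := Fin.insertNth_self_removeNth i (γ w)
    rwa [hrem w hqO] at h1
  refine ⟨w, hqO, fun j => ?_⟩
  induction j using i.succAboveCases with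
  | x =>
    have : IsAlgebraic L (γ w i) := ⟨p, hp0, by rw [hpe, hγw, hγ w hqO]⟩
    have hL : Algebra.IsAlgebraic ℚ L := algebraicClosure.isAlgebraic ℚ ℝ
    exact this.restrictScalars ℚ
  | p j =>
    have h1 : γ w (i.succAbove j) = w j := congrFun (hrem w hqO) j
    rw [h1, ← mem_algebraicClosure_iff, ← hwL]
    exact ((q (i.succAbove j) : ℚ) : L).2

lemma analyticOnNhd_expEval {n : ℕ} (P : MvPolynomial (Fin n ⊕ Fin n) ℝ) :
    AnalyticOnNhd ℝ (expEval P) univ := by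
  intro x _
  have hproj : ∀ j, AnalyticAt ℝ (fun y : Fin n → ℝ => y j) x := fun j =>
    (ContinuousLinearMap.proj (R := ℝ) (φ := fun _ : Fin n => ℝ) j).analyticAt x
  have h : ∀ j : Fin n ⊕ Fin n,
      AnalyticAt ℝ (fun y : Fin n → ℝ => Sum.elim y (fun i => Real.exp (y i)) j) x := by
    rintro (j | j)
    · exact hproj j
    · exact (hproj j).rexp
  exact AnalyticAt.aeval_mvPolynomial h P

lemma finite_Uexps {n : ℕ} (P : MvPolynomial (Fin n ⊕ Fin n) ℝ) : (Uexps P).Finite :=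
  P.support.finite_toSet.image _

lemma isClosed_WP {n : ℕ} (P : MvPolynomial (Fin n ⊕ Fin n) ℝ) : IsClosed (WP P) := by
  have : WP P = ⋃ d ∈ Uexps P, ⋃ e ∈ Uexps P,
      {x | d ≠ e ∧ ∑ i, (d i : ℝ) * x i = ∑ i, (e i : ℝ) * x i} := by
    ext x
    simp only [WP, mem_ofPred_eq, mem_iUnion, exists_prop]
    tauto
  rw [this]
  refine (finite_Uexps P).isClosed_biUnion fun d _ =>
    (finite_Uexps P).isClosed_biUnion fun e _ => ?_
  exact isClosed_const.inter (isClosed_eq (by fun_prop) (by fun_prop))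

/-- The product with `ℝⁿ` of the graph of `γ` over `O`. -/
def graphCylinder {m : ℕ} (O : Set (Fin m → ℝ)) (γ : (Fin m → ℝ) → (Fin (m + 1) → ℝ)) :
    Set (Fin (m + 1) ⊕ Fin (m + 1) → ℝ) :=
  {z | ∃ w ∈ O, ∃ u, z = Sum.elim (γ w) u}

section Graph

variable {m : ℕ} {i : Fin (m + 1)} {O : Set (Fin m → ℝ)}
  {γ : (Fin m → ℝ) → (Fin (m + 1) → ℝ)}

lemma eval_eq_zero_on_graphCylinder {b : MvPolynomial (Fin (m + 1)) ℝ}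
    (hb : ∀ d, IsAlgebraic ℚ (b.coeff d)) (hb0 : b ≠ 0) (hO : IsOpen O)
    (hγc : ContinuousOn γ O) (hrem : ∀ w ∈ O, i.removeNth (γ w) = w)
    (hγb : ∀ w ∈ O, MvPolynomial.eval (γ w) b = 0)
    {Q : MvPolynomial (Fin (m + 1) ⊕ Fin (m + 1)) ℝ} (hQ : ∀ d, IsAlgebraic ℚ (Q.coeff d))
    (hγW : ∀ w ∈ O, γ w ∉ WP Q) (hγQ : ∀ w ∈ O, expEval Q (γ w) = 0) :
    ∀ z ∈ graphCylinder O γ, MvPolynomial.eval z Q = 0 := by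
  rintro _ ⟨w, hw, u, rfl⟩
  by_contra hne
  have hcont : ContinuousOn (fun w => MvPolynomial.eval (Sum.elim (γ w) u) Q) O := by
    refine (MvPolynomial.continuous_eval Q).comp_continuousOn (continuousOn_pi.2 ?_)
    rintro (j | j)
    · exact (continuous_apply j).comp_continuousOn hγc
    · exact continuousOn_const
  have hO' := hcont.isOpen_inter_preimage hO (isOpen_compl_singleton (x := (0 : ℝ)))
  obtain ⟨w', hw', ha⟩ := exists_isAlgebraic_graph hb hb0 hO' ⟨w, hw, hne⟩
    (fun w h => hrem w h.1) (fun w h => hγb w h.1)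
  exact hw'.2 (eval_sumElim_eq_zero_of_expEval_eq_zero hQ ha (hγW w' hw'.1) (hγQ w' hw'.1) u)

lemma eq_zero_of_rename_mem_vanishingIdeal_graphCylinder {K : Subfield ℝ} (hO : IsOpen O)
    (hOne : O.Nonempty) (hrem : ∀ w ∈ O, i.removeNth (γ w) = w)
    (r : MvPolynomial {j : Fin (m + 1) ⊕ Fin (m + 1) // j ≠ Sum.inl i} K)
    (hr : MvPolynomial.rename Subtype.val r ∈
      MvPolynomial.vanishingIdeal K (graphCylinder O γ)) : r = 0 := by
  obtain ⟨w₀, hw₀⟩ := hOne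
  obtain ⟨ε, hε, hball⟩ := Metric.isOpen_iff.1 hO w₀ hw₀
  refine MvPolynomial.map_injective (algebraMap K ℝ) (algebraMap K ℝ).injective ?_
  rw [map_zero]
  refine MvPolynomial.eq_zero_of_eval_eq_zero_on_ball
    (y := fun j => Sum.elim (γ w₀) 0 j.1) hε fun x hx => ?_
  set w : Fin m → ℝ := fun j =>
    x ⟨Sum.inl (i.succAbove j), fun h => i.succAbove_ne j (Sum.inl_injective h)⟩ with hw
  have hwO : w ∈ O := by
    refine hball ?_
    rw [Metric.mem_ball, dist_pi_lt_iff hε]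
    intro j
    have h1 := hx ⟨Sum.inl (i.succAbove j), fun h => i.succAbove_ne j (Sum.inl_injective h)⟩
    have h2 : γ w₀ (i.succAbove j) = w₀ j := congrFun (hrem w₀ hw₀) j
    rw [Metric.mem_ball, Sum.elim_inl, h2] at h1
    exact h1
  have h1 := MvPolynomial.mem_vanishingIdeal_iff.1 hr _
    ⟨w, hwO, fun j => x ⟨Sum.inr j, Sum.inr_ne_inl⟩, rfl⟩
  rw [MvPolynomial.aeval_rename] at h1
  rw [eval_map_eq_aeval, ← h1]
  congr 2
  ext ⟨j | j, hj⟩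
  · obtain ⟨k, rfl⟩ := Fin.exists_succAbove_eq fun h : j = i => hj (congrArg Sum.inl h)
    exact (congrFun (hrem w hwO) k).symm
  · rfl

/-- If an irreducible algebraic hypersurface contains the cylinder over a graph, then the
cylinder is dense in it for the Zariski topology over `K`. -/
lemma vanishingIdeal_graphCylinder_le {K : Subfield ℝ} (hO : IsOpen O) (hOne : O.Nonempty)
    (hrem : ∀ w ∈ O, i.removeNth (γ w) = w)
    {P : MvPolynomial (Fin (m + 1) ⊕ Fin (m + 1)) ℝ} (hP : CoeffsIn K P) (hP0 : P ≠ 0)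
    (hirr : IsIrredAlgSet K {z | MvPolynomial.eval z P = 0})
    (hPγ : ∀ z ∈ graphCylinder O γ, MvPolynomial.eval z P = 0) :
    MvPolynomial.vanishingIdeal K (graphCylinder O γ) ≤
      MvPolynomial.vanishingIdeal K {z | MvPolynomial.eval z P = 0} := by
  have hprime := isPrime_vanishingIdeal_of_isIrredAlgSet hirr
  obtain ⟨P', rfl⟩ := exists_map_eq_of_coeffsIn hP
  refine le_of_isPrime_of_le ?_ (fun f hf z hz => hf z (hPγ z hz)) (Sum.inl i)
    (eq_zero_of_rename_mem_vanishingIdeal_graphCylinder hO hOne hrem)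
  refine ne_of_mem_of_not_mem' (a := P') (fun z hz => ?_) fun h => hP0 ?_
  · rw [← eval_map_eq_aeval]; exact hz
  · rw [Ideal.mem_bot.1 h, map_zero]

lemma eq_zero_of_sum_mul_eq_zero_on_open {c : Fin m → ℝ} (hO : IsOpen O) (hOne : O.Nonempty)
    (h : ∀ w ∈ O, ∑ j, c j * w j = 0) : c = 0 := by
  classical
  obtain ⟨w₀, hw₀⟩ := hOne
  ext j
  have hcont : ContinuousAt (fun t : ℝ => w₀ + t • (Pi.single j 1 : Fin m → ℝ)) 0 := by fun_prop
  have hev : ∀ᶠ t in 𝓝 (0 : ℝ), w₀ + t • (Pi.single j 1 : Fin m → ℝ) ∈ O :=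
    hcont.eventually (by simpa using hO.mem_nhds hw₀)
  obtain ⟨t, ht, ht0⟩ := ((hev.filter_mono nhdsWithin_le_nhds).and
    (self_mem_nhdsWithin : {(0 : ℝ)}ᶜ ∈ 𝓝[≠] 0)).exists
  have h1 := h _ ht
  simp only [Pi.add_apply, Pi.smul_apply, smul_eq_mul, mul_add, Finset.sum_add_distrib,
    h w₀ hw₀, zero_add] at h1
  rw [Finset.sum_eq_single j (fun k _ hk => by simp [Pi.single_eq_of_ne hk]) (by simp)] at h1
  simpa using (mul_eq_zero.1 h1).resolve_right (by simpa using ht0)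

/-- If the hyperplane `∑ c j * x j = 0` contains an analytic graph on which an E-polynomial
vanishes, then the E-polynomial vanishes on the hyperplane. -/
lemma expEval_eq_zero_on_hyperplane (hO : IsOpen O) (hOne : O.Nonempty)
    (hrem : ∀ w ∈ O, i.removeNth (γ w) = w) {c : Fin (m + 1) → ℝ} (hc : c ≠ 0)
    (hcγ : ∀ w ∈ O, ∑ j, c j * γ w j = 0)
    {S : MvPolynomial (Fin (m + 1) ⊕ Fin (m + 1)) ℝ} (hS : ∀ w ∈ O, expEval S (γ w) = 0)
    {v : Fin (m + 1) → ℝ} (hv : ∑ j, c j * v j = 0) : expEval S v = 0 := by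
  have hγs : ∀ w ∈ O, ∀ j, γ w (i.succAbove j) = w j := fun w hw j => congrFun (hrem w hw) j
  have hci : c i ≠ 0 := by
    intro h0
    have h1 : (fun j => c (i.succAbove j)) = 0 :=
      eq_zero_of_sum_mul_eq_zero_on_open hO hOne fun w hw => by
        have := hcγ w hw
        rw [Fin.sum_univ_succAbove _ i, h0, zero_mul, zero_add] at this
        simpa only [hγs w hw] using this
    refine hc (funext fun j => ?_)
    induction j using i.succAboveCases with
    | x => exact h0
    | p j => exact congrFun h1 j
  have huniq : ∀ x, (i.removeNth x : Fin m → ℝ) ∈ O → ∑ j, c j * x j = 0 →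
      γ (i.removeNth x) = x := by
    intro x hx hx0
    have h1 := hcγ _ hx
    rw [Fin.sum_univ_succAbove _ i] at h1 hx0
    simp only [hγs _ hx] at h1
    ext j
    induction j using i.succAboveCases with
    | x => exact mul_left_cancel₀ hci (add_right_cancel (h1.trans hx0.symm))
    | p j => exact hγs _ hx j
  obtain ⟨w₀, hw₀⟩ := hOne
  set g : ℝ → (Fin (m + 1) → ℝ) := fun s => γ w₀ + s • (v - γ w₀) with hg
  have hgan : AnalyticOnNhd ℝ g univ := fun s _ =>
    analyticAt_const.add (analyticAt_id.smul analyticAt_const)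
  have hgH : ∀ s, ∑ j, c j * g s j = 0 := by
    intro s
    have : ∑ j, c j * g s j =
        (1 - s) * ∑ j, c j * γ w₀ j + s * ∑ j, c j * v j := by
      rw [Finset.mul_sum, Finset.mul_sum, ← Finset.sum_add_distrib]
      refine Finset.sum_congr rfl fun j _ => ?_
      simp only [hg, Pi.add_apply, Pi.smul_apply, Pi.sub_apply, smul_eq_mul]
      ring
    rw [this, hcγ w₀ hw₀, hv, mul_zero, mul_zero, add_zero]
  have hev : ∀ᶠ s in 𝓝 (0 : ℝ), expEval S (g s) = 0 := by
    have hg0 : (i.removeNth (g 0) : Fin m → ℝ) = w₀ := by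
      rw [hg]
      simpa using hrem w₀ hw₀
    have hcont : ContinuousAt (fun s => (i.removeNth (g s) : Fin m → ℝ)) 0 :=
      (continuousLinear_removeNth i).continuousAt.comp (hgan 0 (mem_univ _)).continuousAt
    have hO0 : O ∈ 𝓝 (i.removeNth (g 0) : Fin m → ℝ) := hg0 ▸ hO.mem_nhds hw₀
    filter_upwards [hcont.preimage_mem_nhds hO0] with s hs
    rw [← huniq _ hs (hgH s)]
    exact hS _ hs
  by_contra hne
  refine not_eventually_eq_zero_of_preconnected (s := univ)
    (fun s hs => ((analyticOnNhd_expEval S) (g s) (mem_univ _)).comp (hgan s hs))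
    isPreconnected_univ (mem_univ (0 : ℝ)) ⟨1, mem_univ _, ?_⟩ hev
  simpa [hg] using hne

end Graph

lemma ne_univ_of_dimH_eq {m : ℕ} {A : Set (Fin (m + 1) → ℝ)}
    (hA : dimH A = (m : ℝ≥0∞)) : A ≠ univ := by
  rintro rfl
  rw [Real.dimH_univ_pi_fin, Nat.cast_inj] at hA
  exact absurd hA (Nat.succ_ne_self m)

lemma locDim_le_dimH {n : ℕ} (A : Set (Fin n → ℝ)) (x : Fin n → ℝ) : locDim A x ≤ dimH A :=
  (iInf₂_le 1 one_pos).trans (dimH_mono inter_subset_left)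

lemma locDim_le_dimH_inter {n : ℕ} {A U : Set (Fin n → ℝ)} {x : Fin n → ℝ} (hU : U ∈ 𝓝 x) :
    locDim A x ≤ dimH (A ∩ U) := by
  obtain ⟨ε, hε, hball⟩ := Metric.mem_nhds_iff.1 hU
  exact (iInf₂_le ε hε).trans (dimH_mono (inter_subset_inter_right _ hball))

section Graph

variable {m : ℕ} {i : Fin (m + 1)} {O : Set (Fin m → ℝ)}
  {γ : (Fin m → ℝ) → (Fin (m + 1) → ℝ)}

/-- If a graph lies in `WP S` and the vanishing ideal of the cylinder over it is contained in a
prime ideal `I`, then a linear form defining one of the hyperplanes in `WP S` lies in `I`. -/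
lemma exists_linear_mem_of_graph_subset_WP {K : Subfield ℝ}
    {I : Ideal (MvPolynomial (Fin (m + 1) ⊕ Fin (m + 1)) K)} [hI : I.IsPrime]
    (hle : MvPolynomial.vanishingIdeal K (graphCylinder O γ) ≤ I)
    {S : MvPolynomial (Fin (m + 1) ⊕ Fin (m + 1)) ℝ} (hγS : ∀ w ∈ O, γ w ∈ WP S) :
    ∃ d e : Fin (m + 1) → ℕ, d ≠ e ∧
      ∑ j, MvPolynomial.C ((d j : K) - e j) * MvPolynomial.X (Sum.inl j) ∈ I := by
  classical
  set E := (finite_Uexps S).toFinset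
  have hmem : ∏ p ∈ E.offDiag, (∑ j, MvPolynomial.C ((p.1 j : K) - p.2 j) *
      MvPolynomial.X (Sum.inl j) : MvPolynomial (Fin (m + 1) ⊕ Fin (m + 1)) K) ∈ I := by
    refine hle (MvPolynomial.mem_vanishingIdeal_iff.2 ?_)
    rintro _ ⟨w, hw, u, rfl⟩
    obtain ⟨d, e, hd, he, hne, h⟩ := hγS w hw
    rw [map_prod]
    refine Finset.prod_eq_zero (i := (d, e)) ?_ ?_
    · simp [E, hd, he, hne]
    · simp only [map_sum, map_mul, MvPolynomial.aeval_X, Sum.elim_inl,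
        map_sub, map_natCast, sub_mul, Finset.sum_sub_distrib, h, sub_self]
  obtain ⟨p, hp, hpI⟩ := (Ideal.IsPrime.prod_mem_iff (hp := hI)).1 hmem
  exact ⟨p.1, p.2, (Finset.mem_offDiag.1 hp).2.2, hpI⟩

/-- An E-polynomial vanishing on a graph vanishes on `Z(E(P))` as soon as the cylinder over
the graph is dense, for the Zariski topology over `K`, in the irreducible set `Z(P)`. -/
lemma expEval_eq_zero_of_graph {K : Subfield ℝ} (hK : RealAlgExt K)
    {b : MvPolynomial (Fin (m + 1)) ℝ} (hb : CoeffsIn K b) (hb0 : b ≠ 0)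
    (hO : IsOpen O) (hOne : O.Nonempty) (hγc : ContinuousOn γ O)
    (hrem : ∀ w ∈ O, i.removeNth (γ w) = w) (hγb : ∀ w ∈ O, MvPolynomial.eval (γ w) b = 0)
    {P : MvPolynomial (Fin (m + 1) ⊕ Fin (m + 1)) ℝ} (hP : CoeffsIn K P) (hP0 : P ≠ 0)
    (hirr : IsIrredAlgSet K {z | MvPolynomial.eval z P = 0})
    (hγP : ∀ w ∈ O, expEval P (γ w) = 0) (hγW : ∀ w ∈ O, γ w ∉ WP P)
    {S : MvPolynomial (Fin (m + 1) ⊕ Fin (m + 1)) ℝ} (hS : CoeffsIn K S)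
    (hγS : ∀ w ∈ O, expEval S (γ w) = 0)
    {v : Fin (m + 1) → ℝ} (hv : expEval P v = 0) : expEval S v = 0 := by
  have halg : ∀ {σ : Type} {Q : MvPolynomial σ ℝ}, CoeffsIn K Q →
      ∀ d, IsAlgebraic ℚ (Q.coeff d) := fun hQ d => hK ⟨_, hQ d⟩
  have hPγ := eval_eq_zero_on_graphCylinder (halg hb) hb0 hO hγc hrem hγb (halg hP) hγW hγP
  by_cases hW : ∀ w ∈ O, γ w ∈ WP S
  · have hprime := isPrime_vanishingIdeal_of_isIrredAlgSet hirr
    obtain ⟨d, e, hne, hde⟩ := exists_linear_mem_of_graph_subset_WP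
      (vanishingIdeal_graphCylinder_le hO hOne hrem hP hP0 hirr hPγ) hW
    have hlin : ∀ x u : Fin (m + 1) → ℝ, MvPolynomial.eval (Sum.elim x u) P = 0 →
        ∑ j, ((d j : ℝ) - e j) * x j = 0 := by
      intro x u hx
      simpa [map_sum] using MvPolynomial.mem_vanishingIdeal_iff.1 hde _ hx
    refine expEval_eq_zero_on_hyperplane hO hOne hrem (c := fun j => (d j : ℝ) - e j) ?_
      (fun w hw => hlin _ 0 (hPγ _ ⟨w, hw, 0, rfl⟩)) hγS (hlin _ _ hv)
    intro h0
    exact hne (funext fun j => Nat.cast_injective (R := ℝ) (sub_eq_zero.1 (congrFun h0 j)))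
  · push Not at hW
    obtain ⟨w₁, hw₁, hw₁S⟩ := hW
    have hO' := hγc.isOpen_inter_preimage hO (isClosed_WP S).isOpen_compl
    have hSγ := eval_eq_zero_on_graphCylinder (halg hb) hb0 hO' (hγc.mono inter_subset_left)
      (fun w h => hrem w h.1) (fun w h => hγb w h.1) (halg hS) (fun w h => h.2)
      (fun w h => hγS w h.1)
    have hle := vanishingIdeal_graphCylinder_le hO' ⟨w₁, hw₁, hw₁S⟩ (fun w h => hrem w h.1)
      hP hP0 hirr (fun z hz => hPγ z (by obtain ⟨w, hw, u, rfl⟩ := hz; exact ⟨w, hw.1, u, rfl⟩))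
    obtain ⟨S', rfl⟩ := exists_map_eq_of_coeffsIn hS
    have hmem : S' ∈ MvPolynomial.vanishingIdeal K
        (graphCylinder (O ∩ γ ⁻¹' (WP (MvPolynomial.map (algebraMap K ℝ) S'))ᶜ) γ) :=
      MvPolynomial.mem_vanishingIdeal_iff.2 fun z hz => by
        rw [← eval_map_eq_aeval]; exact hSγ z hz
    rw [expEval, eval_map_eq_aeval]
    exact MvPolynomial.mem_vanishingIdeal_iff.1 (hle hmem) _ hv

end Graph

end ExpZeros

/-- If `Z(P)` is irreducible over `𝕂`, `V = Z(E(P))` has dimension `n-1`, and `T = Z(E(S))`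
is an `(n-1)`-dimensional irreducible component of `V` with `Z(S)` irreducible whose
top-dimensional part lies in an `(n-1)`-dimensional algebraic set over `𝕂`, then
either `V = T` or `T_{n-1} ⊆ W_P`. -/
theorem stmt14 (n : ℕ) (K : Subfield ℝ) (hK : RealAlgExt K)
    (P : MvPolynomial (Fin n ⊕ Fin n) ℝ) (hP : CoeffsIn K P)
    (hirrP : IsIrredAlgSet K {z : Fin n ⊕ Fin n → ℝ | MvPolynomial.eval z P = 0})
    (V : Set (Fin n → ℝ)) (hVdef : V = {x | expEval P x = 0})
    (hdimV : dimH V = ((n - 1 : ℕ) : ℝ≥0∞))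
    (T : Set (Fin n → ℝ)) (hT : IsExpComponent K T V)
    (hdimT : dimH T = ((n - 1 : ℕ) : ℝ≥0∞))
    (S : MvPolynomial (Fin n ⊕ Fin n) ℝ) (hS : CoeffsIn K S)
    (hTdef : T = {x | expEval S x = 0})
    (hirrS : IsIrredAlgSet K {z : Fin n ⊕ Fin n → ℝ | MvPolynomial.eval z S = 0})
    (B : Set (Fin n → ℝ)) (hB : IsAlgSet K B) (hdimB : dimH B = ((n - 1 : ℕ) : ℝ≥0∞))
    (hTB : localSet T (n - 1) ⊆ B) :
    V = T ∨ localSet T (n - 1) ⊆ WP P := by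
  subst hVdef hTdef
  obtain _ | m := n
  · obtain ⟨t, ht⟩ := hT.1.2.1
    left
    ext x
    rw [Subsingleton.elim x t]
    exact ⟨fun _ => ht, fun _ => hT.2.1 ht⟩
  rw [Nat.add_sub_cancel] at hdimV hdimT hdimB hTB ⊢
  obtain ⟨b, hb, rfl⟩ := hB
  have hP0 : P ≠ 0 := by
    rintro rfl
    exact ne_univ_of_dimH_eq hdimV (by ext; simp [expEval])
  have hb0 : b ≠ 0 := by
    rintro rfl
    exact ne_univ_of_dimH_eq hdimB (by ext; simp)
  have hS0 : ∃ y, expEval S y ≠ 0 := by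
    by_contra! h
    exact ne_univ_of_dimH_eq hdimT (by ext; simp [h])
  refine or_iff_not_imp_right.2 fun hnot => ?_
  obtain ⟨x₀, hx₀, hx₀W⟩ := not_subset.1 hnot
  have hU : IsOpen (WP P)ᶜ := (isClosed_WP P).isOpen_compl
  obtain ⟨i, w₀, γ, hγ, hγU, hrem, hγS⟩ :=
    exists_analytic_graph_subset_zeros (analyticOnNhd_expEval S) hS0 ⟨x₀, hx₀.1, hx₀W⟩
      (hx₀.2.ge.trans (locDim_le_dimH_inter (hU.mem_nhds hx₀W)))
  obtain ⟨O, hOsub, hO, hw₀⟩ := eventually_nhds_iff.1 (hγ.eventually_analyticAt.and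
    (hrem.and (hγS.and (hγ.continuousAt.eventually (hU.mem_nhds hγU)))))
  have hγB : ∀ w ∈ O, MvPolynomial.eval (γ w) b = 0 := by
    refine fun w hw => hTB ⟨(hOsub w hw).2.2.1, le_antisymm ?_ ?_⟩
    · exact (locDim_le_dimH _ _).trans hdimT.le
    · refine le_iInf₂ fun ε hε => le_dimH_inter_ball_of_graph (hOsub w hw).1.continuousAt
        (i := i) ?_ ?_ hε
      · exact Filter.mem_of_superset (hO.mem_nhds hw) fun w' h => (hOsub w' h).2.1
      · exact Filter.mem_of_superset (hO.mem_nhds hw) fun w' h => (hOsub w' h).2.2.1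
  refine Subset.antisymm (fun v hv => ?_) hT.2.1
  exact expEval_eq_zero_of_graph hK hb hb0 hO ⟨w₀, hw₀⟩
    (fun w hw => (hOsub w hw).1.continuousAt.continuousWithinAt)
    (fun w hw => (hOsub w hw).2.1) hγB hP hP0 hirrP (fun w hw => hT.2.1 (hOsub w hw).2.2.1)
    (fun w hw => (hOsub w hw).2.2.2) hS (fun w hw => (hOsub w hw).2.2.1) hv

end
end

section
/- Let V ⊆ ℝⁿ be a real algebraic set over 𝕂 with dim V = n−1 which is irreducible as a real algebraic set over 𝕂. Then V is irreducible as an exponential set over 𝕂. -/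
open MeasureTheory Set
open scoped ENNReal

noncomputable section

section LindemannWeierstrass

open Polynomial

/-- A finite set of nonzero algebraic numbers is contained in the zero set of an integer polynomial
which does not vanish at `0`. -/
theorem exists_int_polynomial_roots {L : Type*} [Field L] [CharZero L] [Algebra.IsAlgebraic ℚ L]
    (s : Finset L) (hs : (0 : L) ∉ s) :
    ∃ F : ℤ[X], F.eval 0 ≠ 0 ∧ ∀ a ∈ s, aeval a F = 0 := by
  classical
  have key : ∀ a : L, ∃ q : ℤ[X], q.coeff 0 ≠ 0 ∧ (a ≠ 0 → aeval a q = 0) := by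
    intro a
    by_cases ha : a = 0
    · exact ⟨1, by simp, fun h => absurd ha h⟩
    · have h1 : IsAlgebraic ℤ a :=
        (IsFractionRing.isAlgebraic_iff ℤ ℚ L).2 (Algebra.IsAlgebraic.isAlgebraic a)
      obtain ⟨q, h0, h⟩ := h1.exists_nonzero_coeff_and_aeval_eq_zero
        (mem_nonZeroDivisors_of_ne_zero ha)
      exact ⟨q, h0, fun _ => h⟩
  choose q h0 hq using key
  refine ⟨∏ a ∈ s, q a, ?_, fun a ha => ?_⟩
  · rw [eval_prod, Finset.prod_ne_zero_iff]
    intro a _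
    rw [← coeff_zero_eq_eval_zero]
    exact h0 a
  · rw [map_prod]
    exact Finset.prod_eq_zero ha (hq a fun h => hs (h ▸ ha))

/-- If `d * a` is integral and `N` bounds the degree of `g`, then `d ^ N * g(a)` is integral. -/
theorem isIntegral_pow_mul_aeval_s15 {L : Type*} [CommRing L] (d : ℤ) (a : L)
    (h : IsIntegral ℤ ((d : L) * a)) (g : ℤ[X]) (N : ℕ) (hN : g.natDegree ≤ N) :
    IsIntegral ℤ ((d : L) ^ N * aeval a g) := by
  rw [aeval_eq_sum_range, Finset.mul_sum]
  refine IsIntegral.sum _ fun i hi => ?_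
  have hi : i ≤ N := (Nat.lt_succ_iff.1 (Finset.mem_range.1 hi)).trans hN
  have : (d : L) ^ N * g.coeff i • a ^ i =
      ((g.coeff i * d ^ (N - i) : ℤ) : L) * ((d : L) * a) ^ i := by
    obtain ⟨k, rfl⟩ := Nat.exists_eq_add_of_le hi
    simp only [zsmul_eq_mul, Nat.add_sub_cancel_left]
    push_cast
    ring
  rw [this]
  exact (isIntegral_algebraMap (R := ℤ) (A := L)
    (x := g.coeff i * d ^ (N - i))).mul (h.pow i)

/-- An algebraic integer of a Galois extension of `ℚ` that is fixed by the Galois group is an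
integer. -/
theorem exists_int_of_isIntegral_of_fixed {L : Type*} [Field L] [CharZero L] [FiniteDimensional ℚ L]
    [IsGalois ℚ L] (x : L) (hx : IsIntegral ℤ x) (hfix : ∀ σ : L ≃ₐ[ℚ] L, σ x = x) :
    ∃ m : ℤ, x = m := by
  obtain ⟨r, rfl⟩ := IntermediateField.mem_bot.1 ((IsGalois.mem_bot_iff_fixed x).2 hfix)
  have h1 : IsIntegral ℤ r :=
    (isIntegral_algebraMap_iff (algebraMap ℚ L).injective).1 hx
  obtain ⟨m, hm⟩ := IsIntegrallyClosed.isIntegral_iff.1 h1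
  exact ⟨m, by rw [← hm]; simp⟩

/-- Exponential sums with integer coefficients that are constant on Galois orbits and nonzero
at the exponent `0` do not vanish. -/
theorem sum_intCast_mul_exp_ne_zero {L : Type*} [Field L] [CharZero L] [FiniteDimensional ℚ L]
    [IsGalois ℚ L] (φ : L →+* ℂ) (f : L →₀ ℤ) (hinv : ∀ (σ : L ≃ₐ[ℚ] L) a, f (σ a) = f a)
    (h0 : f 0 ≠ 0) : f.sum (fun a m => (m : ℂ) * Complex.exp (φ a)) ≠ 0 := by
  classical
  intro hsum
  set s : Finset L := f.support.erase 0 with hs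
  obtain ⟨F, hF0, hF⟩ := exists_int_polynomial_roots s (by simp [hs])
  have hFne : F ≠ 0 := by rintro rfl; simp at hF0
  obtain ⟨c, hc⟩ := LindemannWeierstrass.exp_polynomial_approx F hF0
  set d : ℤ := F.leadingCoeff with hd
  have hd0 : d ≠ 0 := leadingCoeff_ne_zero.2 hFne
  have hd1 : (1 : ℝ) ≤ |(d : ℝ)| := by exact_mod_cast Int.one_le_abs hd0
  set A : ℝ := ∑ a ∈ s, |(f a : ℝ)| with hA
  set B : ℝ := |(d : ℝ)| ^ F.natDegree * |c| with hB
  have hsum0 : (f 0 : ℂ) + ∑ a ∈ s, (f a : ℂ) * Complex.exp (φ a) = 0 := by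
    rw [Finsupp.sum, ← Finset.add_sum_erase _ _ (Finsupp.mem_support_iff.2 h0)] at hsum
    simpa using hsum
  have htend : Filter.Tendsto (fun p : ℕ => A * B * (B ^ p / (p.factorial : ℝ))) Filter.atTop
      (nhds 0) := by
    simpa using (FloorSemiring.tendsto_pow_div_factorial_atTop B).const_mul (A * B)
  obtain ⟨p₀, hp₀⟩ := Filter.eventually_atTop.1
    (htend.eventually (gt_mem_nhds (zero_lt_one' ℝ)))
  obtain ⟨p, hp_ge, hp⟩ := Nat.exists_infinite_primes
    (p₀ + 1 + (F.eval 0).natAbs + 1 + d.natAbs + (f 0).natAbs + 1)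
  obtain ⟨n, hpn, g, hg, happ⟩ := hc p (by omega) hp
  set N := p * F.natDegree - 1 with hN
  have hmem : ∃ S : ℤ, ∑ a ∈ s, (f a : L) * ((d : L) ^ N * aeval a g) = S := by
    refine exists_int_of_isIntegral_of_fixed _ (IsIntegral.sum _ fun a ha => ?_) fun σ => ?_
    · refine (isIntegral_algebraMap (R := ℤ) (A := L) (x := f a)).mul ?_
      refine isIntegral_pow_mul_aeval_s15 d a ?_ g N hg
      simpa using isIntegral_leadingCoeff_smul F a (hF a ha)
    · rw [map_sum]
      refine Finset.sum_bij (fun a _ => σ a) (fun a ha => ?_) (fun a _ b _ h => σ.injective h)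
        (fun b hb => ⟨σ.symm b, ?_, by simp⟩) (fun a ha => ?_)
      · simpa [hs, hinv] using ha
      · have := hinv σ (σ.symm b)
        simp only [AlgEquiv.apply_symm_apply] at this
        simpa [hs, ← this] using hb
      · rw [map_mul, map_mul, map_pow, map_intCast, map_intCast, hinv]
        congr 2
        exact (aeval_algHom_apply (σ.toAlgHom.restrictScalars ℤ) a g).symm
  obtain ⟨S, hS⟩ := hmem
  have hS' : ∑ a ∈ s, (f a : ℂ) * ((d : ℂ) ^ N * aeval (φ a) g) = S := by
    have := congrArg φ hS
    rw [map_sum, map_intCast] at this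
    rw [← this]
    refine Finset.sum_congr rfl fun a _ => ?_
    rw [map_mul, map_mul, map_pow, map_intCast, map_intCast]
    congr 2
    exact aeval_algHom_apply φ.toIntAlgHom a g
  set T : ℤ := d ^ N * n * f 0 + p * S with hT
  have hTne : T ≠ 0 := by
    intro hT0
    have hp' : Prime (p : ℤ) := Nat.prime_iff_prime_int.1 hp
    have hdvd : (p : ℤ) ∣ d ^ N * n * f 0 := by
      have : d ^ N * n * f 0 = p * (-S) := by linarith
      exact ⟨_, this⟩
    have small : ∀ z : ℤ, z ≠ 0 → z.natAbs < p → ¬ (p : ℤ) ∣ z := by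
      intro z hz hlt hdv
      have := Nat.le_of_dvd (Int.natAbs_pos.2 hz) (Int.natCast_dvd.1 hdv)
      omega
    rcases hp'.dvd_or_dvd hdvd with h | h
    · rcases hp'.dvd_or_dvd h with h | h
      · exact small d hd0 (by omega) (hp'.dvd_of_dvd_pow h)
      · exact hpn h
    · exact small _ h0 (by omega) h
  have hTeq : (T : ℂ) =
      -((d : ℂ) ^ N * ∑ a ∈ s, (f a : ℂ) * (n * Complex.exp (φ a) - p * aeval (φ a) g)) := by
    have e1 : (d : ℂ) ^ N * ∑ a ∈ s, (f a : ℂ) * (n * Complex.exp (φ a) - p * aeval (φ a) g) =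
        (d : ℂ) ^ N * n * ∑ a ∈ s, (f a : ℂ) * Complex.exp (φ a)
        - p * ∑ a ∈ s, (f a : ℂ) * ((d : ℂ) ^ N * aeval (φ a) g) := by
      simp only [Finset.mul_sum, ← Finset.sum_sub_distrib]
      refine Finset.sum_congr rfl fun a _ => ?_
      ring
    rw [e1, hS', hT]
    push_cast
    linear_combination (d : ℂ) ^ N * n * hsum0
  have hnorm : |(T : ℝ)| ≤ |(d : ℝ)| ^ N * (A * (c ^ p / ((p - 1).factorial : ℝ))) := by
    have e2 : |(T : ℝ)| = ‖(T : ℂ)‖ := by simp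
    rw [e2, hTeq, norm_neg, norm_mul, norm_pow, Complex.norm_intCast]
    gcongr
    refine (norm_sum_le _ _).trans ?_
    rw [hA, Finset.sum_mul]
    refine Finset.sum_le_sum fun a ha => ?_
    rw [norm_mul, Complex.norm_intCast]
    gcongr
    have hroot : φ a ∈ F.aroots ℂ := by
      rw [mem_aroots]
      refine ⟨hFne, ?_⟩
      have : aeval (φ a) F = φ (aeval a F) := aeval_algHom_apply φ.toIntAlgHom a F
      rw [this, hF a ha, map_zero]
    simpa using happ hroot
  have hlt : |(d : ℝ)| ^ N * (A * (c ^ p / ((p - 1).factorial : ℝ))) < 1 := by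
    refine lt_of_le_of_lt ?_ (hp₀ (p - 1) (by omega))
    have hA0 : 0 ≤ A := Finset.sum_nonneg fun _ _ => abs_nonneg _
    have e3 : B * B ^ (p - 1) = B ^ p := by
      rw [← pow_succ', Nat.sub_add_cancel hp.one_le]
    have e4 : A * B * (B ^ (p - 1) / ((p - 1).factorial : ℝ)) =
        A * (B ^ p / ((p - 1).factorial : ℝ)) := by rw [← e3]; ring
    have e5 : |(d : ℝ)| ^ N * (A * (c ^ p / ((p - 1).factorial : ℝ))) =
        A * ((|(d : ℝ)| ^ N * c ^ p) / ((p - 1).factorial : ℝ)) := by ring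
    rw [e4, e5]
    gcongr
    rw [hB, mul_pow, ← pow_mul]
    have hc' : c ^ p ≤ |c| ^ p := (le_abs_self _).trans (abs_pow c p).le
    refine (mul_le_mul_of_nonneg_left hc' (by positivity)).trans
      (mul_le_mul_of_nonneg_right (pow_le_pow_right₀ hd1 ?_) (by positivity))
    rw [hN, mul_comm]
    omega
  have h1 : (1 : ℝ) ≤ |(T : ℝ)| := by exact_mod_cast Int.one_le_abs hTne
  linarith

/-- A nonzero formal combination `∑ c_a [a]` over a finite Galois extension `L` of `ℚ` embedded in
`ℂ` has nonzero exponential sum `∑ c_a e^a`. -/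
theorem sum_mul_exp_ne_zero {L : Type*} [Field L] [CharZero L] [FiniteDimensional ℚ L]
    [IsGalois ℚ L] (φ : L →+* ℂ) (f : L →₀ L) (hf : f ≠ 0) :
    f.sum (fun a c => φ c * Complex.exp (φ a)) ≠ 0 := by
  classical
  intro hsum
  let expHom : Multiplicative L →* ℂ :=
    { toFun := fun a => Complex.exp (φ a.toAdd)
      map_one' := by simp
      map_mul' := fun a b => by simp [Complex.exp_add] }
  let ev : AddMonoidAlgebra L L →+* ℂ :=
    AddMonoidAlgebra.liftNCRingHom φ expHom fun _ _ => mul_comm _ _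
  have hev : ∀ x : AddMonoidAlgebra L L,
      ev x = x.coeff.sum (fun a c => φ c * Complex.exp (φ a)) := fun x => rfl
  let ρ : (L ≃ₐ[ℚ] L) → AddMonoidAlgebra L L →+* AddMonoidAlgebra L L :=
    fun σ => AddMonoidAlgebra.mapRingHom L (σ : L →+* L)
  let δ : (L ≃ₐ[ℚ] L) → AddMonoidAlgebra L L →+* AddMonoidAlgebra L L :=
    fun σ => AddMonoidAlgebra.mapDomainRingHom L ((σ : L →+* L) : L →+ L)
  have hρ : ∀ σ x a, (ρ σ x).coeff a = σ (x.coeff a) := by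
    intro σ x a
    simp [ρ]
  have hδ : ∀ σ x a, (δ σ x).coeff (σ a) = x.coeff a := by
    intro σ x a
    exact Finsupp.mapDomain_apply σ.injective x.coeff a
  have hδ' : ∀ σ x a, (δ σ x).coeff a = x.coeff (σ.symm a) := by
    intro σ x a
    rw [← hδ σ x, AlgEquiv.apply_symm_apply]
  have hρne : ∀ σ x, x ≠ 0 → ρ σ x ≠ 0 := by
    intro σ x hx h
    refine hx (AddMonoidAlgebra.coeff_injective (Finsupp.ext fun a => ?_))
    have := hρ σ x a
    rw [h] at this
    simpa using this.symm
  have hδne : ∀ σ x, x ≠ 0 → δ σ x ≠ 0 := by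
    intro σ x hx h
    refine hx (AddMonoidAlgebra.coeff_injective (Finsupp.ext fun a => ?_))
    have := hδ σ x a
    rw [h] at this
    simpa using this.symm
  set x₀ : AddMonoidAlgebra L L := .ofCoeff f with hx₀
  have hx₀ne : x₀ ≠ 0 := fun h => hf (congrArg AddMonoidAlgebra.coeff h)
  have hx₀ev : ev x₀ = 0 := hsum
  set x₁ : AddMonoidAlgebra L L := ∏ σ, ρ σ x₀ with hx₁
  have hx₁ne : x₁ ≠ 0 := Finset.prod_ne_zero_iff.2 fun σ _ => hρne σ _ hx₀ne
  have hx₁ev : ev x₁ = 0 := by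
    rw [hx₁, map_prod]
    refine Finset.prod_eq_zero (Finset.mem_univ 1) ?_
    have : ρ 1 x₀ = x₀ :=
      AddMonoidAlgebra.coeff_injective (Finsupp.ext fun a => by rw [hρ]; rfl)
    rw [this, hx₀ev]
  have hx₁inv : ∀ τ, ρ τ x₁ = x₁ := by
    intro τ
    rw [hx₁, map_prod]
    refine Fintype.prod_equiv (Equiv.mulLeft τ) _ _ fun σ => ?_
    refine AddMonoidAlgebra.coeff_injective (Finsupp.ext fun a => ?_)
    rw [hρ, hρ, hρ]
    rfl
  set x₂ : AddMonoidAlgebra L L := ∏ σ, δ σ x₁ with hx₂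
  have hx₂ne : x₂ ≠ 0 := Finset.prod_ne_zero_iff.2 fun σ _ => hδne σ _ hx₁ne
  have hx₂ev : ev x₂ = 0 := by
    rw [hx₂, map_prod]
    refine Finset.prod_eq_zero (Finset.mem_univ 1) ?_
    have : δ 1 x₁ = x₁ :=
      AddMonoidAlgebra.coeff_injective (Finsupp.ext fun a => by rw [hδ']; rfl)
    rw [this, hx₁ev]
  have hx₂inv : ∀ τ, δ τ x₂ = x₂ := by
    intro τ
    rw [hx₂, map_prod]
    refine Fintype.prod_equiv (Equiv.mulLeft τ) _ _ fun σ => ?_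
    refine AddMonoidAlgebra.coeff_injective (Finsupp.ext fun a => ?_)
    rw [hδ', hδ', hδ']
    rfl
  have hcomm : ∀ σ τ x, ρ σ (δ τ x) = δ τ (ρ σ x) := by
    intro σ τ x
    refine AddMonoidAlgebra.coeff_injective (Finsupp.ext fun a => ?_)
    rw [hρ, hδ', hδ', hρ]
  have hx₂inv' : ∀ τ, ρ τ x₂ = x₂ := by
    intro τ
    rw [hx₂, map_prod]
    refine Finset.prod_congr rfl fun σ _ => ?_
    rw [hcomm, hx₁inv]
  let ν : AddMonoidAlgebra L L →+* AddMonoidAlgebra L L :=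
    AddMonoidAlgebra.mapDomainRingHom L (-AddMonoidHom.id L)
  have hν : ∀ x a, (ν x).coeff (-a) = x.coeff a := fun x a =>
    Finsupp.mapDomain_apply neg_injective x.coeff a
  have hν' : ∀ x a, (ν x).coeff a = x.coeff (-a) := fun x a => by
    simpa using hν x (-a)
  have hνρ : ∀ σ x, ρ σ (ν x) = ν (ρ σ x) := by
    intro σ x
    refine AddMonoidAlgebra.coeff_injective (Finsupp.ext fun a => ?_)
    rw [hρ, hν', hν', hρ]
  have hνδ : ∀ σ x, δ σ (ν x) = ν (δ σ x) := by
    intro σ x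
    refine AddMonoidAlgebra.coeff_injective (Finsupp.ext fun a => ?_)
    rw [hδ', hν', hν', hδ', map_neg σ.symm a]
  set x₃ := x₂ * ν x₂ with hx₃
  have hx₃ev : ev x₃ = 0 := by rw [hx₃, map_mul, hx₂ev, zero_mul]
  have hx₃inv : ∀ (τ : L ≃ₐ[ℚ] L) (a : L), x₃.coeff (τ a) = x₃.coeff a := by
    intro τ a
    have : δ τ x₃ = x₃ := by rw [hx₃, map_mul, hνδ, hx₂inv]
    rw [← hδ τ x₃ a, this]
  have rat : ∀ x, (∀ τ, ρ τ x = x) → ∀ a, ∃ r : ℚ, algebraMap ℚ L r = x.coeff a := by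
    intro x hx a
    refine IntermediateField.mem_bot.1 ((IsGalois.mem_bot_iff_fixed _).2 fun σ => ?_)
    rw [← hρ, hx]
  choose r hr using rat x₃ fun τ => by rw [hx₃, map_mul, hνρ, hx₂inv']
  have hr0 : r 0 ≠ 0 := by
    intro h
    choose q hq using rat x₂ hx₂inv'
    have e : x₃.coeff 0 = ∑ a ∈ x₂.coeff.support, x₂.coeff a * x₂.coeff a := by
      rw [hx₃, AddMonoidAlgebra.coeff_mul, Finsupp.sum]
      refine Finset.sum_congr rfl fun a _ => ?_
      have hsingle : ∀ b, (if a + b = 0 then x₂.coeff a * (ν x₂).coeff b else 0) =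
          if b = -a then x₂.coeff a * (ν x₂).coeff b else 0 := by
        intro b
        simp only [add_comm a b, add_eq_zero_iff_eq_neg]
      simp only [Finsupp.sum, hsingle, Finset.sum_ite_eq', Finsupp.mem_support_iff, hν]
      by_cases h : x₂.coeff a = 0 <;> simp [h]
    have e' : r 0 = ∑ a ∈ x₂.coeff.support, q a * q a := by
      refine (algebraMap ℚ L).injective ?_
      rw [hr, e, map_sum]
      simp only [map_mul, hq]
    rw [h] at e'
    have := (Finset.sum_eq_zero_iff_of_nonneg fun a _ => mul_self_nonneg (q a)).1 e'.symm
    refine hx₂ne (AddMonoidAlgebra.coeff_injective (Finsupp.ext fun a => ?_))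
    by_contra hne
    have hz := mul_self_eq_zero.1 (this a (Finsupp.mem_support_iff.2 hne))
    exact hne (by rw [← hq, hz]; simp)
  obtain ⟨D, hD⟩ := IsLocalization.exist_integer_multiples_of_finset (nonZeroDivisors ℤ)
    (x₃.coeff.support.image r)
  have hD0 : (D : ℤ) ≠ 0 := nonZeroDivisors.coe_ne_zero D
  have hr_zero : ∀ a, x₃.coeff a = 0 ↔ r a = 0 := fun a => by
    rw [← hr, map_eq_zero]
  have hz : ∀ a, ∃ z : ℤ, (z : ℚ) = D * r a := by
    intro a
    by_cases ha : x₃.coeff a = 0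
    · exact ⟨0, by rw [(hr_zero a).1 ha]; simp⟩
    · obtain ⟨z, hz⟩ := hD (r a) (Finset.mem_image_of_mem _ (Finsupp.mem_support_iff.2 ha))
      exact ⟨z, by simpa using hz⟩
  choose z hz using hz
  have hz_zero : ∀ a, z a = 0 ↔ r a = 0 := fun a => by
    rw [← Int.cast_eq_zero (α := ℚ), hz, mul_eq_zero]
    simp [hD0]
  have hrinv : ∀ (σ : L ≃ₐ[ℚ] L) a, r (σ a) = r a := fun σ a =>
    (algebraMap ℚ L).injective (by rw [hr, hr, hx₃inv])
  let g : L →₀ ℤ := Finsupp.onFinset x₃.coeff.support z fun a ha => by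
    rw [Finsupp.mem_support_iff, Ne, hr_zero, ← hz_zero]
    exact ha
  refine sum_intCast_mul_exp_ne_zero φ g (fun σ a => ?_) ?_ ?_
  · change z (σ a) = z a
    have : (z (σ a) : ℚ) = z a := by rw [hz, hz, hrinv]
    exact_mod_cast this
  · change z 0 ≠ 0
    rwa [Ne, hz_zero]
  · rw [Finsupp.onFinset_sum _ fun a => by simp]
    rw [hev, Finsupp.sum] at hx₃ev
    have : ∀ a, (z a : ℂ) = D * φ (x₃.coeff a) := by
      intro a
      have h1 : (z a : L) = D * x₃.coeff a := by
        have := congrArg (algebraMap ℚ L) (hz a)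
        rwa [map_mul, hr, map_intCast, map_intCast] at this
      have := congrArg φ h1
      rwa [map_mul, map_intCast, map_intCast] at this
    simp only [this, mul_assoc, ← Finset.mul_sum]
    rw [hx₃ev, mul_zero]

/-- **Lindemann–Weierstrass theorem**: the exponentials of distinct algebraic numbers are linearly
independent over the algebraic numbers. -/
theorem eq_zero_of_sum_mul_exp_eq_zero {ι : Type*} (s : Finset ι) (a c : ι → ℂ)
    (ha : ∀ i ∈ s, IsAlgebraic ℚ (a i)) (hc : ∀ i ∈ s, IsAlgebraic ℚ (c i))
    (hinj : Set.InjOn a s) (h : ∑ i ∈ s, c i * Complex.exp (a i) = 0) :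
    ∀ i ∈ s, c i = 0 := by
  classical
  let S : Set ℂ := ↑(s.image a ∪ s.image c)
  have hS : ∀ x ∈ S, IsIntegral ℚ x := by
    intro x hx
    simp only [S, Finset.coe_union, Finset.coe_image, Set.mem_union, Set.mem_image] at hx
    rcases hx with ⟨i, hi, rfl⟩ | ⟨i, hi, rfl⟩
    · exact (ha i hi).isIntegral
    · exact (hc i hi).isIntegral
  have : Finite S := Finset.finite_toSet _
  let E : IntermediateField ℚ ℂ := IntermediateField.adjoin ℚ S
  have : FiniteDimensional ℚ E := IntermediateField.finiteDimensional_adjoin hS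
  let L : IntermediateField ℚ ℂ := IntermediateField.normalClosure ℚ E ℂ
  have : FiniteDimensional ℚ L := normalClosure.is_finiteDimensional ℚ E ℂ
  have : IsNormalClosure ℚ E L :=
    (Algebra.IsAlgebraic.of_finite ℚ E).isNormalClosure_normalClosure
      fun x => IsAlgClosed.splits _
  have : Normal ℚ L := IsNormalClosure.normal (K := E)
  have : IsGalois ℚ L := ⟨⟩
  have hEL : E ≤ L := E.le_normalClosure
  have hSL : ∀ x ∈ S, x ∈ L := fun x hx => hEL (IntermediateField.subset_adjoin ℚ S hx)
  have haL : ∀ i ∈ s, a i ∈ L := fun i hi => hSL _ (by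
    simp only [S, Finset.coe_union, Finset.coe_image]
    exact Or.inl ⟨i, hi, rfl⟩)
  have hcL : ∀ i ∈ s, c i ∈ L := fun i hi => hSL _ (by
    simp only [S, Finset.coe_union, Finset.coe_image]
    exact Or.inr ⟨i, hi, rfl⟩)
  let a' : s → L := fun i => ⟨a i, haL i i.2⟩
  let c' : s → L := fun i => ⟨c i, hcL i i.2⟩
  have ha' : Function.Injective a' := fun i j hij =>
    Subtype.ext (hinj i.2 j.2 (congrArg Subtype.val hij))
  let f : L →₀ L := Finsupp.embDomain ⟨a', ha'⟩ (Finsupp.equivFunOnFinite.symm c')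
  have hf : f = 0 := by
    by_contra hne
    refine sum_mul_exp_ne_zero (algebraMap L ℂ) f hne ?_
    rw [Finsupp.sum_embDomain, Finsupp.sum_fintype _ _ (by simp)]
    exact (Finset.sum_coe_sort s fun i => c i * Complex.exp (a i)).trans h
  intro i hi
  have h0 : Finsupp.equivFunOnFinite.symm c' = 0 := by
    rwa [Finsupp.embDomain_eq_zero] at hf
  have := DFunLike.congr_fun h0 ⟨i, hi⟩
  exact congrArg Subtype.val this

/-- The Lindemann–Weierstrass theorem for real algebraic numbers. -/
theorem eq_zero_of_sum_mul_rexp_eq_zero {ι : Type*} (s : Finset ι) (a c : ι → ℝ)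
    (ha : ∀ i ∈ s, IsAlgebraic ℚ (a i)) (hc : ∀ i ∈ s, IsAlgebraic ℚ (c i))
    (hinj : Set.InjOn a s) (h : ∑ i ∈ s, c i * Real.exp (a i) = 0) :
    ∀ i ∈ s, c i = 0 := by
  intro i hi
  have := eq_zero_of_sum_mul_exp_eq_zero s (fun i => (a i : ℂ)) (fun i => (c i : ℂ))
    (fun i hi => (ha i hi).algebraMap) (fun i hi => (hc i hi).algebraMap)
    (fun i hi j hj hij => hinj hi hj (Complex.ofReal_injective hij))
    (by exact_mod_cast congrArg ((↑) : ℝ → ℂ) h) i hi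
  exact_mod_cast this

end LindemannWeierstrass

section Dimension

open MvPolynomial

theorem hasStrictFDerivAt_eval {σ : Type*} [Fintype σ] (p : MvPolynomial σ ℝ) (x : σ → ℝ) :
    HasStrictFDerivAt (fun y => eval y p)
      (∑ i, eval x (pderiv i p) • (ContinuousLinearMap.proj i : (σ → ℝ) →L[ℝ] ℝ)) x := by
  classical
  induction p using MvPolynomial.induction_on with
  | C a =>
    simpa using hasStrictFDerivAt_const (𝕜 := ℝ) (E := σ → ℝ) a x
  | add p q hp hq =>
    simp only [map_add, add_smul, Finset.sum_add_distrib]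
    exact hp.add hq
  | mul_X p j hp =>
    have h := hp.mul (hasStrictFDerivAt_apply (𝕜 := ℝ) j x)
    simp only [map_mul, eval_X]
    refine h.congr_fderiv ?_
    ext v
    simp [Pi.single_apply, pderiv_X, apply_ite, ite_mul, add_mul, Finset.sum_add_distrib,
      Finset.mul_sum, mul_assoc]

theorem dimH_coord_subspace_le {σ : Type*} [Fintype σ] (S : Finset σ) :
    dimH {y : σ → ℝ | ∀ j, j ∉ S → y j = 0} ≤ S.card := by
  classical
  let f : (S → ℝ) → σ → ℝ := fun z j => if h : j ∈ S then z ⟨j, h⟩ else 0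
  have hf : ContDiff ℝ 1 f := by
    rw [contDiff_pi]
    intro j
    by_cases h : j ∈ S
    · simpa [f, h] using contDiff_apply ℝ ℝ (⟨j, h⟩ : S)
    · simpa [f, h] using contDiff_const
  have hr := hf.dimH_range_le
  rw [Module.finrank_pi, Fintype.card_coe] at hr
  refine (dimH_mono ?_).trans hr
  intro y hy
  refine ⟨fun i => y i, ?_⟩
  ext j
  by_cases h : j ∈ S
  · simp [f, h]
  · simp [f, h, hy j h]

theorem dimH_triangular_zeros_le {σ : Type*} [Fintype σ] (S : Finset σ)
    (g : σ → MvPolynomial σ ℝ)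
    (hg : ∀ i j, i ∉ S → j ∉ S → i ≠ j → pderiv i (g j) = 0) :
    dimH {x : σ → ℝ | ∀ j, j ∉ S → eval x (g j) = 0 ∧ eval x (pderiv j (g j)) ≠ 0} ≤ S.card := by
  classical
  by_contra! hlt
  obtain ⟨x, hx, hxt⟩ := exists_mem_nhdsWithin_lt_dimH_of_lt_dimH hlt
  let q : σ → MvPolynomial σ ℝ := fun j => if j ∈ S then X j else g j
  let G : (σ → ℝ) → σ → ℝ := fun y j => eval y (q j)
  let D : (σ → ℝ) →L[ℝ] σ → ℝ := ContinuousLinearMap.pi fun j =>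
    ∑ i, eval x (pderiv i (q j)) • (ContinuousLinearMap.proj i : (σ → ℝ) →L[ℝ] ℝ)
  have hG : HasStrictFDerivAt G D x := by
    rw [hasStrictFDerivAt_pi']
    exact fun j => hasStrictFDerivAt_eval (q j) x
  have hDapp : ∀ v j, D v j = ∑ i, eval x (pderiv i (q j)) * v i := by
    intro v j
    simp [D]
  have hDinj : Function.Injective (D : (σ → ℝ) →ₗ[ℝ] σ → ℝ) := by
    rw [injective_iff_map_eq_zero]
    intro v hv
    have hv' : ∀ j, ∑ i, eval x (pderiv i (q j)) * v i = 0 := fun j => by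
      rw [← hDapp]
      exact congrFun hv j
    have hS : ∀ j ∈ S, v j = 0 := by
      intro j hj
      have := hv' j
      rw [Finset.sum_eq_single j] at this
      · simpa [q, hj] using this
      · intro i _ hi
        simp [q, hj, pderiv_X_of_ne hi.symm]
      · simp
    ext j
    by_cases hj : j ∈ S
    · exact hS j hj
    have := hv' j
    rw [Finset.sum_eq_single j] at this
    · simpa [q, hj, (hx j hj).2] using this
    · intro i _ hi
      by_cases hiS : i ∈ S
      · simp [hS i hiS]
      · simp [q, hj, hg i j hiS hj hi]
    · simp
  let e : (σ → ℝ) ≃L[ℝ] σ → ℝ := (LinearEquiv.ofInjectiveEndo _ hDinj).toContinuousLinearEquiv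
  have he : (e : (σ → ℝ) →L[ℝ] σ → ℝ) = D := by
    ext v j
    rfl
  rw [← he] at hG
  obtain ⟨C, N, hN, hC⟩ := hG.to_localInverse.exists_lipschitzOnWith
  have hU : ∀ᶠ y in nhds x, hG.localInverse G e x (G y) = y ∧ G y ∈ N :=
    hG.eventually_left_inverse.and (hG.continuousAt hN)
  have h1 := hxt _ (inter_mem_nhdsWithin _ hU)
  refine absurd h1 (not_lt.2 ?_)
  refine le_trans ?_ (dimH_coord_subspace_le S)
  refine le_trans (dimH_mono ?_) ((hC.mono Set.inter_subset_right).dimH_image_le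
    (s := {y : σ → ℝ | ∀ j, j ∉ S → y j = 0} ∩ N) |>.trans (dimH_mono Set.inter_subset_left))
  rintro y ⟨hy, hyU, hyN⟩
  refine ⟨G y, ⟨fun j hj => ?_, hyN⟩, hyU⟩
  simpa [G, q, hj] using (hy j hj).1

theorem exists_separable_relation {σ F L : Type*} [Field F] [Field L] [CharZero L]
    [Algebra F L] (x : σ → L) (S : Set σ) {j : σ} (hj : j ∉ S)
    (halg : IsAlgebraic (Algebra.adjoin F (x '' S)) (x j)) :
    ∃ g : MvPolynomial σ F, aeval x g = 0 ∧ aeval x (pderiv j g) ≠ 0 ∧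
      ∀ i, i ∉ S → i ≠ j → pderiv i g = 0 := by
  classical
  set A := Algebra.adjoin F (x '' S) with hA
  obtain ⟨q, ⟨hq0, hq⟩, hmin⟩ : ∃ q : Polynomial A, (q ≠ 0 ∧ Polynomial.aeval (x j) q = 0) ∧
      ∀ r : Polynomial A, r ≠ 0 ∧ Polynomial.aeval (x j) r = 0 → q.natDegree ≤ r.natDegree := by
    have hne : {q : Polynomial A | q ≠ 0 ∧ Polynomial.aeval (x j) q = 0}.Nonempty := halg
    refine ⟨Function.argminOn Polynomial.natDegree _ hne, Function.argminOn_mem _ _ hne,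
      fun r hr => Function.argminOn_le (f := Polynomial.natDegree) _ hr⟩
  have hinj : Function.Injective (algebraMap A L) := Subtype.val_injective
  have hdeg : q.natDegree ≠ 0 := by
    intro h
    rw [Polynomial.eq_C_of_natDegree_eq_zero h] at hq hq0
    rw [Polynomial.aeval_C, map_eq_zero_iff _ hinj] at hq
    simp [hq] at hq0
  have hder : Polynomial.aeval (x j) (Polynomial.derivative q) ≠ 0 := by
    intro h
    have h0 : Polynomial.derivative q ≠ 0 := by
      intro h0
      exact hdeg (Polynomial.derivative_eq_zero.1 h0)
    exact absurd (hmin _ ⟨h0, h⟩) (not_le.2 (Polynomial.natDegree_derivative_lt hdeg))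
  let φ : MvPolynomial S F →ₐ[F] A :=
    aeval fun i : S => (⟨x i, Algebra.subset_adjoin ⟨i, i.2, rfl⟩⟩ : A)
  have hφval : ∀ r, (φ r : L) = aeval x (rename Subtype.val r) := by
    intro r
    rw [aeval_rename]
    have : (A.val.comp φ) = aeval (x ∘ Subtype.val) := by
      ext i
      simp [φ]
    exact DFunLike.congr_fun this r
  have hφ : Function.Surjective φ := by
    rintro ⟨a, ha⟩
    have hr : x '' S = Set.range (fun i : S => x i) := by
      ext; simp
    have ha' := ha
    rw [hA, hr, Algebra.adjoin_range_eq_range_aeval] at ha'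
    obtain ⟨r, hr⟩ := ha'
    refine ⟨r, Subtype.ext ?_⟩
    rw [hφval, aeval_rename]
    exact hr
  obtain ⟨Q, rfl⟩ := Polynomial.map_surjective (φ : MvPolynomial S F →+* A) hφ q
  let ι : MvPolynomial S F →+* MvPolynomial σ F := (rename Subtype.val : MvPolynomial S F →ₐ[F] MvPolynomial σ F)
  have hev : ∀ R : Polynomial (MvPolynomial S F),
      aeval x (Polynomial.eval₂ ι (X j) R) =
        Polynomial.aeval (x j) (R.map (φ : MvPolynomial S F →+* A)) := by
    intro R
    rw [← AlgHom.coe_toRingHom, Polynomial.hom_eval₂, Polynomial.aeval_def,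
      Polynomial.eval₂_map]
    congr 1
    · exact RingHom.ext fun r => (hφval r).symm
    · simp
  have hι : ∀ i, i ∉ S → ∀ r, pderiv i (ι r) = 0 := by
    intro i hi r
    refine pderiv_eq_zero_of_notMem_vars fun hmem => ?_
    obtain ⟨s, -, hs⟩ := Finset.mem_image.1 (vars_rename Subtype.val r hmem)
    exact hi (hs ▸ s.2)
  have hpd : ∀ i, i ∉ S → ∀ R : Polynomial (MvPolynomial S F),
      pderiv i (Polynomial.eval₂ ι (X j) R) =
        Polynomial.eval₂ ι (X j) (Polynomial.derivative R) * pderiv i (X j) := by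
    intro i hi R
    induction R using Polynomial.induction_on' with
    | add p q hp hq => simp [hp, hq, Polynomial.eval₂_add, add_mul]
    | monomial m a =>
      simp [Polynomial.eval₂_monomial, Polynomial.derivative_monomial, Derivation.leibniz,
        hι i hi, Derivation.leibniz_pow, mul_assoc]
  refine ⟨Polynomial.eval₂ ι (X j) Q, ?_, ?_, ?_⟩
  · rw [hev, hq]
  · rw [hpd j hj, pderiv_X_self, mul_one, hev, ← Polynomial.derivative_map]
    exact hder
  · intro i hi hij
    rw [hpd i hi, pderiv_X_of_ne hij.symm, mul_zero]

theorem countable_mvPolynomial {σ F : Type*} [Field F] [Countable σ] [Countable F] :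
    Countable (MvPolynomial σ F) := by
  rw [← Cardinal.mk_le_aleph0_iff]
  refine MvPolynomial.cardinalMk_le_max_lift.trans ?_
  simp [Cardinal.mk_le_aleph0]

theorem dimH_le_of_card_algebraicIndepOn_le {σ F : Type*} [Fintype σ] [Field F] [Countable F]
    [Algebra F ℝ] {V : Set (σ → ℝ)} {d : ℕ}
    (h : ∀ x ∈ V, ∀ S : Finset σ, AlgebraicIndepOn F x (S : Set σ) → S.card ≤ d) :
    dimH V ≤ d := by
  classical
  have : Countable (MvPolynomial σ F) := countable_mvPolynomial
  let Z : Finset σ × (σ → MvPolynomial σ F) → Set (σ → ℝ) := fun w =>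
    {x | ∀ j, j ∉ w.1 → eval x (map (algebraMap F ℝ) (w.2 j)) = 0 ∧
      eval x (pderiv j (map (algebraMap F ℝ) (w.2 j))) ≠ 0}
  let I : Set (Finset σ × (σ → MvPolynomial σ F)) := {w | w.1.card ≤ d ∧
    ∀ i j, i ∉ w.1 → j ∉ w.1 → i ≠ j → pderiv i (w.2 j) = 0}
  have hV : V ⊆ ⋃ w ∈ I, Z w := by
    intro x hx
    obtain ⟨S, hS⟩ := (Set.toFinite {S : Finset σ | AlgebraicIndepOn F x (S : Set σ)}).exists_maximal
      ⟨∅, by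
        have : IsEmpty ((∅ : Finset σ) : Set σ) := by simp
        exact algebraicIndependent_empty_type⟩
    have key : ∀ j, ∃ g : MvPolynomial σ F, j ∉ S → aeval x g = 0 ∧ aeval x (pderiv j g) ≠ 0 ∧
        ∀ i, i ∉ S → i ≠ j → pderiv i g = 0 := by
      intro j
      by_cases hj : j ∈ S
      · exact ⟨0, fun h => absurd hj h⟩
      have halg : IsAlgebraic (Algebra.adjoin F (x '' (S : Set σ))) (x j) := by
        by_contra htr
        have h1 := AlgebraicIndepOn.insert hS.1 htr
        rw [← Finset.coe_insert] at h1
        exact hj (hS.2 h1 (Finset.subset_insert j S) (Finset.mem_insert_self j S))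
      obtain ⟨g, hg⟩ := exists_separable_relation x (S : Set σ) (by simpa using hj) halg
      exact ⟨g, fun _ => by simpa using hg⟩
    choose g hg using key
    refine Set.mem_biUnion (x := (S, g)) ⟨h x hx S hS.1, fun i j hi hj hij => (hg j hj).2.2 i hi hij⟩
      fun j hj => ?_
    rw [pderiv_map, eval_map, eval_map, ← aeval_def, ← aeval_def]
    exact ⟨(hg j hj).1, (hg j hj).2.1⟩
  refine (dimH_mono hV).trans ?_
  rw [dimH_bUnion (Set.to_countable I)]
  refine iSup₂_le fun w hw => ?_
  refine (dimH_triangular_zeros_le w.1 (fun j => map (algebraMap F ℝ) (w.2 j)) ?_).trans ?_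
  · intro i j hi hj hij
    rw [pderiv_map, hw.2 i j hi hj hij, map_zero]
  · exact_mod_cast hw.1

end Dimension

section GenericPoint

open MvPolynomial

theorem Polynomial.dvd_of_irreducible_of_eval₂_eq_zero {R E : Type*} [CommRing R] [IsDomain R]
    [UniqueFactorizationMonoid R] [Field E] (φ : R →+* E) (hφ : Function.Injective φ) (t : E)
    {P Q : Polynomial R} (hP : Irreducible P) (hPt : P.eval₂ φ t = 0) (hQt : Q.eval₂ φ t = 0) :
    P.natDegree ≠ 0 ∧ P ∣ Q := by
  have hdeg : P.natDegree ≠ 0 := by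
    intro h
    have hC := Polynomial.eq_C_of_natDegree_eq_zero h
    rw [hC, Polynomial.eval₂_C, map_eq_zero_iff _ hφ] at hPt
    rw [hPt, Polynomial.C_0] at hC
    exact hP.ne_zero hC
  refine ⟨hdeg, ?_⟩
  classical
  let _ := UniqueFactorizationMonoid.strongNormalizationMonoid (α := R)
  let _ := UniqueFactorizationMonoid.toNormalizedGCDMonoid R
  let k := FractionRing R
  let ψ : k →+* E := IsFractionRing.lift hφ
  have hψ : ψ.comp (algebraMap R k) = φ := by
    ext r
    exact IsFractionRing.lift_algebraMap hφ r
  have hirr : Irreducible (P.map (algebraMap R k)) :=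
    ((hP.isPrimitive hdeg).irreducible_iff_irreducible_map_fraction_map).1 hP
  have hev : ∀ S : Polynomial R, (S.map (algebraMap R k)).eval₂ ψ t = S.eval₂ φ t := by
    intro S
    rw [Polynomial.eval₂_map, hψ]
  have hdvd : P.map (algebraMap R k) ∣ Q.map (algebraMap R k) := by
    by_contra hnd
    obtain ⟨a, b, hab⟩ := (hirr.coprime_iff_not_dvd).2 hnd
    have := congrArg (Polynomial.eval₂ ψ t) hab
    simp [Polynomial.eval₂_add, Polynomial.eval₂_mul, hev, hPt, hQt] at this
  obtain ⟨S, hS⟩ := hdvd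
  obtain ⟨b, hbm, hb⟩ := IsLocalization.integerNormalization_spec (nonZeroDivisors R) S
  have hinj : Function.Injective (Polynomial.map (algebraMap R k)) :=
    Polynomial.map_injective _ (IsFractionRing.injective R k)
  have hPS : Polynomial.C b * Q =
      P * IsLocalization.integerNormalization (nonZeroDivisors R) S := by
    apply hinj
    rw [Polynomial.map_mul, Polynomial.map_mul, hS, hb, Polynomial.map_C]
    rw [← algebraMap_smul k b S, Polynomial.smul_eq_C_mul]
    ring
  have hprime : Prime P := hP.prime
  rcases hprime.dvd_or_dvd ⟨_, hPS⟩ with h | h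
  · have hb0 : b ≠ 0 := nonZeroDivisors.ne_zero hbm
    have := Polynomial.natDegree_le_of_dvd h (by simpa using hb0)
    rw [Polynomial.natDegree_C] at this
    omega
  · exact h

/-- Polynomials in the variables `σ`, viewed as univariate polynomials in the variable `j`. -/
def univariateEquiv {σ : Type*} [DecidableEq σ] (F : Type*) [Field F] (j : σ) :
    MvPolynomial σ F ≃ₐ[F] Polynomial (MvPolynomial {i // i ≠ j} F) :=
  (renameEquiv F (Equiv.optionSubtypeNe j).symm).trans (optionEquivLeft F {i // i ≠ j})

theorem eval₂_univariateEquiv {σ : Type*} [DecidableEq σ] {F E : Type*} [Field F] [CommRing E]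
    [Algebra F E] (j : σ) (y : σ → E) (q : MvPolynomial σ F) :
    (univariateEquiv F j q).eval₂
      (aeval fun i : {i // i ≠ j} => y i : MvPolynomial {i // i ≠ j} F →ₐ[F] E) (y j) =
      aeval y q := by
  induction q using MvPolynomial.induction_on with
  | C a => simp [univariateEquiv]
  | add p q hp hq => rw [map_add, Polynomial.eval₂_add, hp, hq, map_add]
  | mul_X p i hp =>
    rw [map_mul, Polynomial.eval₂_mul, hp, map_mul, aeval_X]
    congr 1
    by_cases hi : i = j
    · subst hi
      simp [univariateEquiv]
    · simp [univariateEquiv, hi]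

theorem univariateEquiv_generic {σ : Type*} [DecidableEq σ] {F E : Type*} [Field F] [Field E]
    [Algebra F E] {j : σ} {x : σ → E}
    (hx : AlgebraicIndependent F fun i : {i // i ≠ j} => x i) {p q : MvPolynomial σ F}
    (hp : Irreducible p) (hpx : aeval x p = 0) (hqx : aeval x q = 0) :
    (univariateEquiv F j p).natDegree ≠ 0 ∧ univariateEquiv F j p ∣ univariateEquiv F j q := by
  refine Polynomial.dvd_of_irreducible_of_eval₂_eq_zero
    (aeval fun i : {i // i ≠ j} => x i : MvPolynomial {i // i ≠ j} F →ₐ[F] E).toRingHom hx (x j)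
    ((MulEquiv.irreducible_iff (univariateEquiv F j)).2 hp) ?_ ?_
  · exact (eval₂_univariateEquiv j x p).trans hpx
  · exact (eval₂_univariateEquiv j x q).trans hqx

theorem dvd_of_aeval_generic_eq_zero {σ : Type*} {F E : Type*} [Field F] [Field E]
    [Algebra F E] {j : σ} {x : σ → E}
    (hx : AlgebraicIndependent F fun i : {i // i ≠ j} => x i) {p q : MvPolynomial σ F}
    (hp : Irreducible p) (hpx : aeval x p = 0) (hqx : aeval x q = 0) : p ∣ q := by
  classical
  exact (map_dvd_iff (univariateEquiv F j)).1 (univariateEquiv_generic hx hp hpx hqx).2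

theorem exists_eval_mul_eval_neg_of_simple_root (P : Polynomial ℝ) {t : ℝ} (h : P.IsRoot t)
    (hd : P.derivative.eval t ≠ 0) {ε : ℝ} (hε : 0 < ε) :
    ∃ s u, s < u ∧ |s - t| < ε ∧ |u - t| < ε ∧ P.eval s * P.eval u < 0 := by
  obtain ⟨r, rfl⟩ := Polynomial.dvd_iff_isRoot.2 h
  have hr : r.eval t ≠ 0 := by simpa using hd
  have hc : ∀ᶠ s in nhds t, 0 < r.eval s * r.eval t :=
    (r.continuous.mul continuous_const).continuousAt.eventually
      (lt_mem_nhds (mul_self_pos.2 hr))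
  obtain ⟨δ, hδ, hball⟩ := Metric.eventually_nhds_iff.1 hc
  set η := min δ ε / 2 with hη
  have hη0 : 0 < η := by positivity
  have hηδ : η < δ := by have := min_le_left δ ε; linarith
  have hηε : η < ε := by have := min_le_right δ ε; linarith
  refine ⟨t - η, t + η, by linarith, by simpa [abs_of_pos hη0], by simpa [abs_of_pos hη0], ?_⟩
  have h1 := hball (y := t - η) (by simpa [Real.dist_eq, abs_of_pos hη0])
  have h2 := hball (y := t + η) (by simpa [Real.dist_eq, abs_of_pos hη0])
  have h3 : 0 < r.eval (t - η) * r.eval (t + η) := by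
    have := mul_pos h1 h2
    have hsq : 0 < r.eval t ^ 2 := by positivity
    refine pos_of_mul_pos_left (b := r.eval t ^ 2) ?_ hsq.le
    linarith
  simp only [Polynomial.eval_mul, Polynomial.eval_sub, Polynomial.eval_X, Polynomial.eval_C]
  have : 0 < η ^ 2 * (r.eval (t - η) * r.eval (t + η)) := by positivity
  linarith

theorem isAlgebraic_of_isRoot_of_coeff {P : Polynomial ℝ} (hP : P ≠ 0)
    (hcoeff : ∀ m, IsAlgebraic ℚ (P.coeff m)) {s : ℝ} (hs : P.IsRoot s) : IsAlgebraic ℚ s := by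
  let A : IntermediateField ℚ ℝ := algebraicClosure ℚ ℝ
  have : Algebra.IsAlgebraic ℚ A := algebraicClosure.isAlgebraic ℚ ℝ
  obtain ⟨Q, rfl⟩ : ∃ Q : Polynomial A, Q.map (algebraMap A ℝ) = P := by
    rw [← Polynomial.mem_lifts, Polynomial.lifts_iff_coeff_lifts]
    exact fun m => ⟨⟨P.coeff m, mem_algebraicClosure_iff.2 (hcoeff m)⟩, rfl⟩
  have : IsAlgebraic A s := ⟨Q, fun h => hP (by simp [h]), by
    rw [Polynomial.aeval_def, ← Polynomial.eval_map]; exact hs⟩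
  exact this.restrictScalars ℚ

theorem isAlgebraic_aeval {σ F : Type*} [Field F] [Algebra F ℝ]
    (hF : ∀ a : F, IsAlgebraic ℚ (algebraMap F ℝ a)) {y : σ → ℝ} (hy : ∀ i, IsAlgebraic ℚ (y i))
    (q : MvPolynomial σ F) : IsAlgebraic ℚ (aeval y q) := by
  induction q using MvPolynomial.induction_on with
  | C a => simpa using hF a
  | add p q hp hq => simpa using hp.add hq
  | mul_X p i hp => simpa using hp.mul (hy i)

theorem continuous_aeval {σ F : Type*} [Field F] [Algebra F ℝ] (q : MvPolynomial σ F) :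
    Continuous fun y : σ → ℝ => aeval y q := by
  induction q using MvPolynomial.induction_on with
  | C a => simpa using continuous_const
  | add p q hp hq =>
    simp only [map_add]
    exact hp.add hq
  | mul_X p i hp =>
    simp only [map_mul, aeval_X]
    exact hp.mul (continuous_apply i)

theorem exists_algebraic_zero_near_generic {σ F : Type*} [Fintype σ] [Field F] [Algebra F ℝ]
    (hF : ∀ a : F, IsAlgebraic ℚ (algebraMap F ℝ a)) {j : σ} {x : σ → ℝ}
    (hx : AlgebraicIndependent F fun i : {i // i ≠ j} => x i) {p : MvPolynomial σ F}
    (hp : Irreducible p) (hpx : aeval x p = 0) {U : Set (σ → ℝ)} (hU : U ∈ nhds x) :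
    ∃ z ∈ U, (∀ i, IsAlgebraic ℚ (z i)) ∧ aeval z p = 0 := by
  classical
  let P := univariateEquiv F j p
  let φ : (σ → ℝ) → MvPolynomial {i // i ≠ j} F →+* ℝ := fun y =>
    (aeval fun i : {i // i ≠ j} => y i : MvPolynomial {i // i ≠ j} F →ₐ[F] ℝ)
  have hev : ∀ y s, (P.map (φ y)).eval s = aeval (Function.update y j s) p := by
    intro y s
    rw [← eval₂_univariateEquiv j, Polynomial.eval_map, Function.update_self]
    congr 1
    refine ringHom_ext (fun a => ?_) fun i => ?_
    · simp [φ]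
    · simp [φ, i.2]
  obtain ⟨hdeg, -⟩ := univariateEquiv_generic hx hp hpx hpx
  have : CharZero F := (algebraMap F ℝ).charZero
  have hroot : (P.map (φ x)).IsRoot (x j) := by
    rw [Polynomial.IsRoot, hev, Function.update_eq_self, hpx]
  have hder : (P.map (φ x)).derivative.eval (x j) ≠ 0 := by
    intro h
    rw [Polynomial.derivative_map, Polynomial.eval_map] at h
    obtain ⟨-, hdvd⟩ := Polynomial.dvd_of_irreducible_of_eval₂_eq_zero (φ x) hx (x j)
      ((MulEquiv.irreducible_iff (univariateEquiv F j)).2 hp)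
      (by rw [← Polynomial.eval_map]; exact hroot) h
    have h0 : Polynomial.derivative P ≠ 0 := fun h0 => hdeg (Polynomial.derivative_eq_zero.1 h0)
    exact absurd (Polynomial.natDegree_le_of_dvd hdvd h0)
      (not_le.2 (Polynomial.natDegree_derivative_lt hdeg))
  obtain ⟨ε, hε, hball⟩ := Metric.mem_nhds_iff.1 hU
  obtain ⟨s, u, hsu, hs, hu, hneg⟩ := exists_eval_mul_eval_neg_of_simple_root _ hroot hder hε
  have hcont : ∀ s, Continuous fun y => (P.map (φ y)).eval s := by
    intro s
    simp only [hev]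
    exact (continuous_aeval p).comp (continuous_id.update j continuous_const)
  have hev' : ∀ᶠ y in nhds x, (P.map (φ y)).eval s * (P.map (φ y)).eval u < 0 :=
    ((hcont s).mul (hcont u)).continuousAt.eventually (gt_mem_nhds hneg)
  have hdense : DenseRange (fun (v : σ → ℚ) i => (v i : ℝ)) :=
    DenseRange.piMap fun _ => Rat.denseRange_cast
  obtain ⟨_, ⟨hyneg, hyball⟩, v, rfl⟩ := mem_closure_iff_nhds.1 (hdense x) _
    (hev'.and (Metric.ball_mem_nhds x hε))
  set y : σ → ℝ := fun i => (v i : ℝ) with hy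
  obtain ⟨w, ⟨hw1, hw2⟩, hw⟩ : ∃ w ∈ Set.Icc s u, (P.map (φ y)).eval w = 0 := by
    have hpc : ContinuousOn (fun w => (P.map (φ y)).eval w) (Set.Icc s u) :=
      (P.map (φ y)).continuous.continuousOn
    rcases mul_neg_iff.1 hyneg with h | h
    · exact intermediate_value_Icc' hsu.le hpc ⟨h.2.le, h.1.le⟩
    · exact intermediate_value_Icc hsu.le hpc ⟨h.1.le, h.2.le⟩
  have hyalg : ∀ i, IsAlgebraic ℚ (y i) := fun i => isAlgebraic_algebraMap (v i)
  have hwalg : IsAlgebraic ℚ w := by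
    refine isAlgebraic_of_isRoot_of_coeff (P := P.map (φ y)) ?_ (fun m => ?_) hw
    · intro h
      rw [h] at hyneg
      simp at hyneg
    · rw [Polynomial.coeff_map]
      exact isAlgebraic_aeval hF (y := fun i : {i // i ≠ j} => y i) (fun i => hyalg i) _
  refine ⟨Function.update y j w, hball ?_, fun i => ?_, by rw [← hev, hw]⟩
  · rw [Metric.mem_ball, dist_pi_lt_iff hε]
    intro i
    by_cases hi : i = j
    · subst hi
      rw [Function.update_self, Real.dist_eq]
      rw [abs_lt] at *
      constructor <;> linarith [hs.1, hu.2]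
    · rw [Function.update_of_ne hi]
      exact (dist_pi_lt_iff hε).1 hyball i
  · by_cases hi : i = j
    · subst hi
      simpa using hwalg
    · simpa [hi] using hyalg i

end GenericPoint

section AlgebraicSets

open MvPolynomial

theorem coeffsIn_iff {σ : Type*} {K : Subfield ℝ} {P : MvPolynomial σ ℝ} :
    CoeffsIn K P ↔ ∃ p : MvPolynomial σ K, map (algebraMap K ℝ) p = P := by
  rw [← Set.mem_range, mem_range_map_iff_coeffs_subset]
  have hr : Set.range (algebraMap K ℝ) = (K : Set ℝ) := Subtype.range_coe
  rw [hr]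
  constructor
  · intro h c hc
    obtain ⟨m, -, rfl⟩ := mem_coeffs_iff.1 (Finset.mem_coe.1 hc)
    exact h m
  · intro h m
    by_cases hm : P.coeff m = 0
    · rw [hm]
      exact K.zero_mem
    · exact h (Finset.mem_coe.2 (coeff_mem_coeffs m hm))

theorem isAlgSet_iff {σ : Type*} {K : Subfield ℝ} {S : Set (σ → ℝ)} :
    IsAlgSet K S ↔ ∃ p : MvPolynomial σ K, S = {x | aeval x p = 0} := by
  constructor
  · rintro ⟨P, hP, rfl⟩
    obtain ⟨p, rfl⟩ := coeffsIn_iff.1 hP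
    exact ⟨p, by simp [eval_map, aeval_def]⟩
  · rintro ⟨p, rfl⟩
    exact ⟨_, coeffsIn_iff.2 ⟨p, rfl⟩, by simp [eval_map, aeval_def]⟩

/-- The point `(x, e^x)`. -/
def expPoint {n : ℕ} (x : Fin n → ℝ) : Fin n ⊕ Fin n → ℝ :=
  Sum.elim x fun i => Real.exp (x i)

theorem isExpSet_iff {n : ℕ} {K : Subfield ℝ} {S : Set (Fin n → ℝ)} :
    IsExpSet K S ↔ ∃ p : MvPolynomial (Fin n ⊕ Fin n) K, S = {x | aeval (expPoint x) p = 0} := by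
  constructor
  · rintro ⟨P, hP, rfl⟩
    obtain ⟨p, rfl⟩ := coeffsIn_iff.1 hP
    exact ⟨p, by simp [eval_map, aeval_def, expEval, expPoint]⟩
  · rintro ⟨p, rfl⟩
    exact ⟨_, coeffsIn_iff.2 ⟨p, rfl⟩, by simp [eval_map, aeval_def, expEval, expPoint]⟩

theorem IsAlgSet.isExpSet {n : ℕ} {K : Subfield ℝ} {S : Set (Fin n → ℝ)} (h : IsAlgSet K S) :
    IsExpSet K S := by
  obtain ⟨p, rfl⟩ := isAlgSet_iff.1 h
  refine isExpSet_iff.2 ⟨rename Sum.inl p, ?_⟩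
  ext x
  simp only [Set.mem_ofPred_eq, aeval_rename]
  rfl

theorem IsIrredAlgSet.vanishing_or_vanishing {σ : Type*} {K : Subfield ℝ} {V : Set (σ → ℝ)}
    (hV : IsIrredAlgSet K V) {q r : MvPolynomial σ K} (h : ∀ x ∈ V, aeval x (q * r) = 0) :
    (∀ x ∈ V, aeval x q = 0) ∨ ∀ x ∈ V, aeval x r = 0 := by
  obtain ⟨halg, -, hirr⟩ := hV
  obtain ⟨f, hf⟩ := isAlgSet_iff.1 halg
  have hz : ∀ q : MvPolynomial σ K,
      V ∩ {x | aeval x q = 0} = {x | aeval x (f ^ 2 + q ^ 2) = 0} := by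
    intro q
    ext x
    simp only [hf, Set.mem_inter_iff, Set.mem_ofPred_eq, map_add, map_pow]
    constructor
    · rintro ⟨h1, h2⟩
      simp [h1, h2]
    · intro h
      constructor <;> nlinarith [sq_nonneg (aeval x f), sq_nonneg (aeval x q)]
  by_contra! hcon
  obtain ⟨⟨a, haV, ha⟩, b, hbV, hb⟩ := hcon
  refine hirr ⟨V ∩ {x | aeval x q = 0}, V ∩ {x | aeval x r = 0}, isAlgSet_iff.2 ⟨_, hz q⟩,
    isAlgSet_iff.2 ⟨_, hz r⟩, ?_, ?_, ?_⟩
  · ext x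
    simp only [Set.mem_union, Set.mem_inter_iff, Set.mem_ofPred_eq, ← and_or_left]
    refine ⟨fun hx => ⟨hx, ?_⟩, fun hx => hx.1⟩
    have := h x hx
    rwa [map_mul, mul_eq_zero] at this
  · exact ⟨Set.inter_subset_left, fun hs => ha (hs haV).2⟩
  · exact ⟨Set.inter_subset_left, fun hs => hb (hs hbV).2⟩

theorem IsIrredAlgSet.exists_irreducible {σ : Type*} {K : Subfield ℝ} {V : Set (σ → ℝ)}
    (hV : IsIrredAlgSet K V) (huniv : V ≠ Set.univ) :
    ∃ p : MvPolynomial σ K, Irreducible p ∧ V = {x | aeval x p = 0} := by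
  obtain ⟨f, hf⟩ := isAlgSet_iff.1 hV.1
  have hf0 : f ≠ 0 := by
    rintro rfl
    exact huniv (by simpa using hf)
  have key : ∀ g : MvPolynomial σ K, g ≠ 0 → (∀ x ∈ V, aeval x g = 0) →
      ∃ p, Irreducible p ∧ p ∣ g ∧ ∀ x ∈ V, aeval x p = 0 := by
    intro g
    induction g using UniqueFactorizationMonoid.induction_on_prime with
    | h₁ => exact fun h => absurd rfl h
    | h₂ u hu =>
      intro _ h
      obtain ⟨x, hx⟩ := hV.2.1
      have := hu.map (aeval x : MvPolynomial σ K →ₐ[K] ℝ)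
      rw [h x hx] at this
      exact absurd this not_isUnit_zero
    | h₃ a p ha hp ih =>
      intro _ h
      rcases hV.vanishing_or_vanishing h with h | h
      · exact ⟨p, hp.irreducible, dvd_mul_right p a, h⟩
      · obtain ⟨r, hr, hdvd, hrV⟩ := ih ha h
        exact ⟨r, hr, hdvd.mul_left p, hrV⟩
  obtain ⟨p, hp, ⟨c, hc⟩, hpV⟩ := key f hf0 fun x hx => by rwa [hf] at hx
  refine ⟨p, hp, Set.Subset.antisymm hpV fun x hx => ?_⟩
  rw [Set.mem_ofPred_eq] at hx
  rw [hf, Set.mem_ofPred_eq, hc, map_mul, hx, zero_mul]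

theorem exists_generic_point {m : ℕ} {F : Type*} [Field F] [Countable F] [Algebra F ℝ]
    {V : Set (Fin (m + 1) → ℝ)} (hne : V.Nonempty) (hdim : dimH V = m) :
    ∃ x ∈ V, ∃ j : Fin (m + 1), AlgebraicIndependent F fun i : {i // i ≠ j} => x i := by
  obtain ⟨x, hx, S, hS, hcard⟩ : ∃ x ∈ V, ∃ S : Finset (Fin (m + 1)),
      AlgebraicIndepOn F x (S : Set (Fin (m + 1))) ∧ m ≤ S.card := by
    by_contra! hcon
    rcases m with _ | k
    · obtain ⟨x, hx⟩ := hne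
      have : IsEmpty ((∅ : Finset (Fin (0 + 1))) : Set (Fin (0 + 1))) := by simp
      exact absurd (hcon x hx ∅ algebraicIndependent_empty_type) (by simp)
    · have := dimH_le_of_card_algebraicIndepOn_le (F := F) (V := V) (d := k)
        fun x hx S hS => Nat.lt_succ_iff.1 (hcon x hx S hS)
      rw [hdim] at this
      have := (Nat.cast_le (α := ENNReal)).1 this
      omega
  obtain ⟨T, hTS, hT⟩ := Finset.exists_subset_card_eq hcard
  obtain ⟨j, hj⟩ : ∃ j, Tᶜ = {j} := Finset.card_eq_one.1 (by simp [Finset.card_compl, hT])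
  refine ⟨x, hx, j, ?_⟩
  have hmem : ∀ i : {i // i ≠ j}, (i : Fin (m + 1)) ∈ (S : Set (Fin (m + 1))) := by
    intro i
    refine hTS ?_
    by_contra h
    have : (i : Fin (m + 1)) ∈ Tᶜ := Finset.mem_compl.2 h
    rw [hj, Finset.mem_singleton] at this
    exact i.2 this
  exact AlgebraicIndependent.comp hS (fun i : {i // i ≠ j} => ⟨i, hmem i⟩)
    fun a b hab => Subtype.ext (by simpa using hab)

end AlgebraicSets

section ExponentialSets

open MvPolynomial

/-- A polynomial in `X₁,…,Xₙ,U₁,…,Uₙ` viewed as a polynomial in the `Uᵢ` with coefficients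
polynomials in the `Xᵢ`. -/
def expIter {n : ℕ} (F : Type*) [Field F] :
    MvPolynomial (Fin n ⊕ Fin n) F →ₐ[F] MvPolynomial (Fin n) (MvPolynomial (Fin n) F) :=
  aeval (Sum.elim (fun i => C (X i)) X)

theorem eval₂_expIter {n : ℕ} {F : Type*} [Field F] [Algebra F ℝ]
    (q : MvPolynomial (Fin n ⊕ Fin n) F) (x : Fin n → ℝ) :
    (expIter F q).eval₂ (aeval x : MvPolynomial (Fin n) F →ₐ[F] ℝ).toRingHom
      (fun i => Real.exp (x i)) = aeval (expPoint x) q := by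
  induction q using MvPolynomial.induction_on with
  | C a => simp [expIter, MvPolynomial.algebraMap_apply]
  | add p q hp hq => rw [map_add, eval₂_add, hp, hq, map_add]
  | mul_X p i hp =>
    rw [map_mul, eval₂_mul, hp, map_mul, aeval_X]
    congr 1
    rcases i with i | i <;> simp [expIter, expPoint]

theorem eval₂_exp_eq_sum {n : ℕ} {F : Type*} [Field F] [Algebra F ℝ]
    (R : MvPolynomial (Fin n) (MvPolynomial (Fin n) F)) (x : Fin n → ℝ) :
    R.eval₂ (aeval x : MvPolynomial (Fin n) F →ₐ[F] ℝ).toRingHom (fun i => Real.exp (x i)) =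
      ∑ m ∈ R.support, aeval x (R.coeff m) * Real.exp (∑ i, (m i : ℝ) * x i) := by
  rw [eval₂_eq']
  refine Finset.sum_congr rfl fun m _ => ?_
  rw [Real.exp_sum]
  simp only [← Real.exp_nat_mul]
  rfl

/-- The linear form `∑ᵢ (mᵢ - m'ᵢ) Xᵢ`. -/
def diffForm {n : ℕ} (F : Type*) [Field F] (m m' : Fin n →₀ ℕ) : MvPolynomial (Fin n) F :=
  ∑ i, C ((m i : F) - m' i) * X i

theorem aeval_diffForm {n : ℕ} {F : Type*} [Field F] [Algebra F ℝ] (m m' : Fin n →₀ ℕ)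
    (x : Fin n → ℝ) :
    aeval x (diffForm F m m') = ∑ i, (m i : ℝ) * x i - ∑ i, (m' i : ℝ) * x i := by
  simp [diffForm, sub_mul, Finset.sum_sub_distrib]

theorem aeval_diffForm_line {n : ℕ} {F : Type*} [Field F] [Algebra F ℝ] (m m' : Fin n →₀ ℕ)
    (a b : Fin n → ℝ) (t : ℝ) :
    aeval (fun i => a i + t * (b i - a i)) (diffForm F m m') =
      aeval a (diffForm F m m') + t * (aeval b (diffForm F m m') - aeval a (diffForm F m m')) := by
  simp only [aeval_diffForm, mul_sub, Finset.mul_sum, ← Finset.sum_sub_distrib,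
    ← Finset.sum_add_distrib]
  exact Finset.sum_congr rfl fun i _ => by ring

theorem totalDegree_diffForm_le {n : ℕ} {F : Type*} [Field F] (m m' : Fin n →₀ ℕ) :
    (diffForm F m m').totalDegree ≤ 1 := by
  refine totalDegree_finsetSum_le fun i _ => ?_
  refine (totalDegree_mul _ _).trans ?_
  rw [totalDegree_C, totalDegree_X]

theorem diffForm_ne_zero {n : ℕ} {F : Type*} [Field F] [Algebra F ℝ] {m m' : Fin n →₀ ℕ}
    (h : m ≠ m') : diffForm F m m' ≠ 0 := by
  intro h0
  refine h (Finsupp.ext fun j => ?_)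
  have := aeval_diffForm (F := F) m m' (Pi.single j 1)
  rw [h0, map_zero] at this
  simp [Pi.single_apply] at this
  exact_mod_cast (sub_eq_zero.1 this.symm)

theorem mem_zeros_iff_of_irreducible_dvd {σ F : Type*} [Field F] [Algebra F ℝ]
    {p L : MvPolynomial σ F} (hp : Irreducible p) (hL0 : L ≠ 0) (hL : L.totalDegree ≤ 1)
    (hdvd : p ∣ L) (x : σ → ℝ) : aeval x p = 0 ↔ aeval x L = 0 := by
  obtain ⟨c, rfl⟩ := hdvd
  have hp0 : p ≠ 0 := hp.ne_zero
  have hc0 : c ≠ 0 := right_ne_zero_of_mul hL0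
  rw [totalDegree_mul_of_isDomain hp0 hc0] at hL
  have hpdeg : p.totalDegree ≠ 0 := by
    intro h
    rw [totalDegree_eq_zero_iff_eq_C] at h
    refine hp.not_isUnit ?_
    rw [h]
    refine IsUnit.map C (isUnit_iff_ne_zero.2 fun h' => hp0 ?_)
    rw [h, h', C_0]
  have hc : c = C (c.coeff 0) := totalDegree_eq_zero_iff_eq_C.1 (by omega)
  have ha : c.coeff 0 ≠ 0 := fun h => hc0 (by rw [hc, h, C_0])
  rw [hc, map_mul, aeval_C, mul_eq_zero, map_eq_zero (algebraMap F ℝ)]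
  simp [ha]

theorem analyticOnNhd_aeval_expPoint_line {n : ℕ} {F : Type*} [Field F] [Algebra F ℝ]
    (q : MvPolynomial (Fin n ⊕ Fin n) F) (a b : Fin n → ℝ) :
    AnalyticOnNhd ℝ (fun t : ℝ => aeval (expPoint fun i => a i + t * b i) q) Set.univ := by
  induction q using MvPolynomial.induction_on with
  | C c =>
    simp only [aeval_C]
    exact analyticOnNhd_const
  | add p q hp hq =>
    simp only [map_add]
    exact hp.add hq
  | mul_X p i hp =>
    simp only [map_mul, aeval_X]
    refine hp.mul ?_
    have hline : ∀ j, AnalyticOnNhd ℝ (fun t : ℝ => a j + t * b j) Set.univ := fun j =>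
      analyticOnNhd_const.add (analyticOnNhd_id.mul analyticOnNhd_const)
    rcases i with j | j
    · exact hline j
    · exact (hline j).rexp

theorem coeff_vanishing_at_algebraic_point {n : ℕ} {F : Type*} [Field F] [Algebra F ℝ]
    (hF : ∀ a : F, IsAlgebraic ℚ (algebraMap F ℝ a))
    (R : MvPolynomial (Fin n) (MvPolynomial (Fin n) F)) {z : Fin n → ℝ}
    (hz : ∀ i, IsAlgebraic ℚ (z i))
    (hL : ∀ m ∈ R.support, ∀ m' ∈ R.support, m ≠ m' → aeval z (diffForm F m m') ≠ 0)
    (h : R.eval₂ (aeval z : MvPolynomial (Fin n) F →ₐ[F] ℝ).toRingHom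
      (fun i => Real.exp (z i)) = 0) :
    ∀ m ∈ R.support, aeval z (R.coeff m) = 0 := by
  rw [eval₂_exp_eq_sum] at h
  refine eq_zero_of_sum_mul_rexp_eq_zero R.support (fun m => ∑ i, (m i : ℝ) * z i)
    (fun m => aeval z (R.coeff m)) (fun m _ => ?_) (fun m _ => isAlgebraic_aeval hF hz _) ?_ h
  · rw [← mem_algebraicClosure_iff]
    exact sum_mem fun i _ => mem_algebraicClosure_iff.2 ((isAlgebraic_natCast _).mul (hz i))
  · intro m hm m' hm' heq
    by_contra hne
    refine hL m hm m' hm' hne ?_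
    rw [aeval_diffForm]
    exact sub_eq_zero.2 heq

end ExponentialSets

theorem IsIrredAlgSet.isIrredExpSet_of_hypersurface {m : ℕ} {K : Subfield ℝ} (hK : RealAlgExt K)
    {V : Set (Fin (m + 1) → ℝ)} (hirr : IsIrredAlgSet K V) (hdim : dimH V = m) :
    IsIrredExpSet K V := by
  classical
  refine ⟨hirr.1.isExpSet, hirr.2.1, ?_⟩
  rintro ⟨V₁, V₂, h₁, h₂, hV, hV₁, hV₂⟩
  obtain ⟨p₁, rfl⟩ := isExpSet_iff.1 h₁
  obtain ⟨p₂, rfl⟩ := isExpSet_iff.1 h₂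
  have hprod : ∀ x, x ∈ V →
      MvPolynomial.aeval (expPoint x) p₁ * MvPolynomial.aeval (expPoint x) p₂ = 0 := by
    intro x hx
    rw [hV] at hx
    exact mul_eq_zero.2 hx
  obtain ⟨a, haV, ha⟩ := Set.exists_of_ssubset hV₁
  obtain ⟨b, hbV, hb⟩ := Set.exists_of_ssubset hV₂
  have hcount : Countable K := by
    have : ((K : Set ℝ)).Countable := (Algebraic.countable ℚ ℝ).mono fun c hc => hK ⟨c, hc⟩
    exact this.to_subtype
  have hK' : ∀ c : K, IsAlgebraic ℚ (algebraMap K ℝ c) := hK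
  obtain ⟨x, hx, j, hind⟩ := exists_generic_point (F := K) hirr.2.1 hdim
  obtain ⟨p, hp, hpV⟩ := hirr.exists_irreducible (by
    rintro rfl
    rw [Real.dimH_univ_pi_fin] at hdim
    have := (Nat.cast_inj (R := ENNReal)).1 hdim
    omega)
  have hpx : MvPolynomial.aeval x p = 0 := by rwa [hpV] at hx
  have hgen : ∀ q : MvPolynomial (Fin (m + 1)) K, MvPolynomial.aeval x q = 0 → p ∣ q := fun q hq =>
    dvd_of_aeval_generic_eq_zero hind hp hpx hq
  have hvan : ∀ q : MvPolynomial (Fin (m + 1)) K, MvPolynomial.aeval x q = 0 → ∀ y ∈ V, MvPolynomial.aeval y q = 0 := by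
    intro q hq y hy
    obtain ⟨c, rfl⟩ := hgen q hq
    rw [hpV, Set.mem_ofPred_eq] at hy
    rw [map_mul, hy, zero_mul]
  have hdense : ∀ q : MvPolynomial (Fin (m + 1)) K,
      (∀ z ∈ V, (∀ i, IsAlgebraic ℚ (z i)) → MvPolynomial.aeval z q = 0) →
      MvPolynomial.aeval x q = 0 := by
    intro q hq
    by_contra hne
    obtain ⟨z, hzU, hz, hzp⟩ := exists_algebraic_zero_near_generic hK' hind hp hpx
      ((continuous_aeval q).continuousAt.eventually (isOpen_ne.mem_nhds hne))
    exact hzU (hq z (by rwa [hpV]) hz)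
  set R := expIter K (p₁ * p₂) with hR
  have hRV : ∀ z ∈ V, R.eval₂ (MvPolynomial.aeval z : _ →ₐ[K] ℝ).toRingHom
      (fun i => Real.exp (z i)) = 0 := by
    intro z hz
    rw [hR, eval₂_expIter, map_mul, hprod z hz]
  by_cases hcase : ∃ d ∈ R.support, ∃ d' ∈ R.support,
      d ≠ d' ∧ MvPolynomial.aeval x (diffForm K d d') = 0
  · obtain ⟨d, -, d', -, hdd, hL⟩ := hcase
    have hVL : ∀ y, y ∈ V ↔ MvPolynomial.aeval y (diffForm K d d') = 0 := by
      intro y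
      rw [hpV, Set.mem_ofPred_eq]
      exact mem_zeros_iff_of_irreducible_dvd hp (diffForm_ne_zero hdd)
        (totalDegree_diffForm_le d d') (hgen _ hL) y
    have hline : ∀ t : ℝ, (fun i => a i + t * (b i - a i)) ∈ V := by
      intro t
      rw [hVL, aeval_diffForm_line, (hVL a).1 haV, (hVL b).1 hbV]
      simp
    have han := fun q => analyticOnNhd_aeval_expPoint_line (F := K) q a (fun i => b i - a i)
    rcases (han p₁).eq_zero_or_eq_zero_of_mul_eq_zero (han p₂)
      (fun t _ => hprod _ (hline t)) isPreconnected_univ with h | h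
    · exact ha (by simpa using h 0 (Set.mem_univ _))
    · exact hb (by simpa using h 1 (Set.mem_univ _))
  · push Not at hcase
    have hcoeff : ∀ d ∈ R.support, MvPolynomial.aeval x (R.coeff d) = 0 := by
      intro d hd
      let D := ∏ w ∈ (R.support ×ˢ R.support).filter (fun w => w.1 ≠ w.2), diffForm K w.1 w.2
      have hDx : MvPolynomial.aeval x D ≠ 0 := by
        rw [map_prod, Finset.prod_ne_zero_iff]
        intro w hw
        rw [Finset.mem_filter, Finset.mem_product] at hw
        exact hcase _ hw.1.1 _ hw.1.2 hw.2
      have hzero : MvPolynomial.aeval x (R.coeff d * D) = 0 := by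
        refine hdense _ fun z hz hzalg => ?_
        rw [map_mul, mul_eq_zero, or_iff_not_imp_right]
        intro hDz
        rw [map_prod, ← ne_eq, Finset.prod_ne_zero_iff] at hDz
        refine coeff_vanishing_at_algebraic_point hK' R hzalg (fun e he e' he' hee => ?_)
          (hRV z hz) d hd
        exact hDz (e, e') (by simp [he, he', hee])
      rw [map_mul] at hzero
      exact (mul_eq_zero.1 hzero).resolve_right hDx
    let φ : MvPolynomial (Fin (m + 1)) K →+* ℝ :=
      (MvPolynomial.aeval x : MvPolynomial (Fin (m + 1)) K →ₐ[K] ℝ).toRingHom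
    have hmap : MvPolynomial.map φ (expIter K p₁) * MvPolynomial.map φ (expIter K p₂) = 0 := by
      rw [← map_mul, ← map_mul]
      ext d
      rw [MvPolynomial.coeff_map, MvPolynomial.coeff_zero]
      by_cases hd : d ∈ R.support
      · exact hcoeff d hd
      · rw [MvPolynomial.notMem_support_iff.1 hd, map_zero]
    have hfin : ∀ q : MvPolynomial (Fin (m + 1) ⊕ Fin (m + 1)) K, MvPolynomial.map φ (expIter K q) = 0 →
        ∀ y ∈ V, MvPolynomial.aeval (expPoint y) q = 0 := by
      intro q hq y hy
      rw [← eval₂_expIter, eval₂_exp_eq_sum]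
      refine Finset.sum_eq_zero fun d _ => ?_
      have hd : MvPolynomial.aeval x ((expIter K q).coeff d) = 0 := by
        have := congrArg (MvPolynomial.coeff d) hq
        rwa [MvPolynomial.coeff_map, MvPolynomial.coeff_zero] at this
      rw [hvan _ hd y hy, zero_mul]
    rcases mul_eq_zero.1 hmap with h | h
    · exact ha (hfin p₁ h a haV)
    · exact hb (hfin p₂ h b hbV)

/-- An `(n-1)`-dimensional real algebraic set over `𝕂` which is irreducible as a real
algebraic set over `𝕂` is irreducible as an exponential set over `𝕂`. -/
theorem stmt15 (n : ℕ) (K : Subfield ℝ) (hK : RealAlgExt K)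
    (V : Set (Fin n → ℝ)) (hirr : IsIrredAlgSet K V)
    (hdim : dimH V = ((n - 1 : ℕ) : ℝ≥0∞)) :
    IsIrredExpSet K V := by
  rcases n with _ | m
  · refine ⟨hirr.1.isExpSet, hirr.2.1, ?_⟩
    rintro ⟨V₁, V₂, -, -, hV, hV₁, hV₂⟩
    have hempty : ∀ W, W ⊂ V → W = ∅ := fun W hW =>
      Set.not_nonempty_iff_eq_empty.1 fun hW' => hW.2 fun x _ => by
        obtain ⟨y, hy⟩ := hW'
        rwa [Subsingleton.elim x y]
    rw [hempty V₁ hV₁, hempty V₂ hV₂, Set.union_empty] at hV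
    exact hirr.2.1.ne_empty hV
  · exact hirr.isIrredExpSet_of_hypersurface hK hdim

end
end
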